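/- arXiv:1005.4278 — 2 statements merged into one kernel-verified Lean document; each statement's English description precedes it below -/
import Mathlib

section
/- For every n ≥ 4, the largest total degree of a binomial in the Graver basis of I_{K_n} equals n − 2, and this maximal degree is attained by a circuit of I_{K_n}. -/
open MvPolynomial

noncomputable section

/-! ### Term orders, initial terms, (reduced) Gröbner bases, universal Gröbner basis -/

/-- A term order on the monomials (exponent vectors) in variables indexed by `σ`:
a linear order for which `0` is least and which is compatible with addition. -/
structure TermOrder (σ : Type*) where
  lo : LinearOrder (σ →₀ ℕ)
  zero_min : ∀ u : σ →₀ ℕ, lo.le 0 u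
  add_right : ∀ u v w : σ →₀ ℕ, lo.le u v → lo.le (u + w) (v + w)

variable {σ : Type*} {K : Type*} [Field K]

/-- The leading (largest) exponent of a polynomial with respect to a term order
(junk value `0` if `f = 0`). -/
def TermOrder.leadExp (t : TermOrder σ) (f : MvPolynomial σ K) : σ →₀ ℕ :=
  haveI := Classical.propDecidable (f = 0)
  if h : f = 0 then 0
  else @Finset.max' _ t.lo f.support
    (Finset.nonempty_iff_ne_empty.mpr fun he => h (MvPolynomial.support_eq_empty.mp he))

/-- The initial term of a polynomial with respect to a term order. -/
def TermOrder.initial (t : TermOrder σ) (f : MvPolynomial σ K) : MvPolynomial σ K :=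
  monomial (t.leadExp f) (f.coeff (t.leadExp f))

/-- `𝒢` is a Gröbner basis of `I` w.r.t. the term order `t`. -/
def IsGroebnerBasis (t : TermOrder σ) (I : Ideal (MvPolynomial σ K))
    (𝒢 : Finset (MvPolynomial σ K)) : Prop :=
  (𝒢 : Set (MvPolynomial σ K)) ⊆ (I : Set (MvPolynomial σ K)) ∧
    Ideal.span (t.initial '' (𝒢 : Set (MvPolynomial σ K))) =
      Ideal.span (t.initial '' (I : Set (MvPolynomial σ K)))

/-- `𝒢` is a reduced Gröbner basis of `I` w.r.t. `t`: a Gröbner basis, all of whose elements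
are monic, and no monomial occurring in an element of `𝒢` is divisible by the initial term of
a different element of `𝒢`. -/
def IsReducedGroebnerBasis (t : TermOrder σ) (I : Ideal (MvPolynomial σ K))
    (𝒢 : Finset (MvPolynomial σ K)) : Prop :=
  IsGroebnerBasis t I 𝒢 ∧
    (∀ g ∈ 𝒢, g.coeff (t.leadExp g) = 1) ∧
    (∀ g ∈ 𝒢, ∀ g' ∈ 𝒢, g' ≠ g → ∀ u ∈ g.support, ¬ t.leadExp g' ≤ u)

/-- The universal Gröbner basis of `I`: the union of all reduced Gröbner bases of `I`
over all term orders. -/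
def UniversalGB (I : Ideal (MvPolynomial σ K)) : Set (MvPolynomial σ K) :=
  {f | ∃ (t : TermOrder σ) (𝒢 : Finset (MvPolynomial σ K)),
    IsReducedGroebnerBasis t I 𝒢 ∧ f ∈ 𝒢}

/-! ### Binomials, primitive binomials (Graver basis), circuits -/

/-- The binomial `x^u - x^v`. -/
def binom (K : Type*) [Field K] {σ : Type*} (u v : σ →₀ ℕ) : MvPolynomial σ K :=
  monomial u 1 - monomial v 1

/-- `f` is a primitive binomial of `I`: `f = x^u - x^v ∈ I` and there is no other binomial
`x^w - x^z ∈ I` with `x^w ∣ x^u` and `x^z ∣ x^v`.  The set of primitive binomials of `I`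
is the Graver basis of `I`. -/
def IsPrimitiveBinomial (I : Ideal (MvPolynomial σ K)) (f : MvPolynomial σ K) : Prop :=
  ∃ u v : σ →₀ ℕ, u ≠ v ∧ f = binom K u v ∧ f ∈ I ∧
    ∀ w z : σ →₀ ℕ, w ≠ z → binom K w z ∈ I → w ≤ u → z ≤ v → w = u ∧ z = v

/-- `f` is a circuit of `I`: an irreducible binomial of `I` whose support (set of variables
occurring in it) is minimal among the supports of nonzero binomials of `I`. -/
def IsCircuitBinomial (I : Ideal (MvPolynomial σ K)) (f : MvPolynomial σ K) : Prop :=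
  (∃ u v : σ →₀ ℕ, u ≠ v ∧ f = binom K u v) ∧ f ∈ I ∧ Irreducible f ∧
    ∀ g : MvPolynomial σ K, (∃ u v : σ →₀ ℕ, u ≠ v ∧ g = binom K u v) → g ∈ I →
      g.vars ⊆ f.vars → g.vars = f.vars

/-- The toric ideal of a vector configuration `A = (a_1, …, a_m) ⊆ ℕ^n`: the ideal generated
by all binomials `x^u - x^v` with `Σ uᵢ aᵢ = Σ vᵢ aᵢ`. -/
def toricIdealOfConfig (K : Type*) [Field K] {m n : ℕ} (A : Fin m → Fin n → ℕ) :
    Ideal (MvPolynomial (Fin m) K) :=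
  Ideal.span {f | ∃ u v : Fin m →₀ ℕ,
    f = binom K u v ∧ (∑ i, u i • A i) = ∑ i, v i • A i}

/-! ### Toric ideals of graphs -/

variable {V : Type*}

/-- The image `x_u * x_v` of an edge `e = {u, v}`. -/
def edgeImage (K : Type*) [Field K] {V : Type*} (e : Sym2 V) : MvPolynomial V K :=
  Sym2.lift ⟨fun a b => X a * X b, fun a b => mul_comm _ _⟩ e

/-- The toric ideal `I_G` of a graph `G`: the kernel of the `K`-algebra map
`K[e : e ∈ E(G)] → K[x_v : v ∈ V(G)]`, `e = {u,v} ↦ x_u x_v`. -/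
def graphToricIdeal (K : Type*) [Field K] (G : SimpleGraph V) :
    Ideal (MvPolynomial G.edgeSet K) :=
  RingHom.ker (MvPolynomial.aeval
    (fun e : G.edgeSet => edgeImage K (e : Sym2 V)) :
      MvPolynomial G.edgeSet K →ₐ[K] MvPolynomial V K).toRingHom

/-- An even closed walk `(v_0, v_1, …, v_{2q} = v_0)` in a graph `G`;
edges and vertices may repeat. -/
structure EvenClosedWalk (G : SimpleGraph V) where
  q : ℕ
  verts : ℕ → V
  adj : ∀ i, i < 2 * q → G.Adj (verts i) (verts (i + 1))
  closed : verts (2 * q) = verts 0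

namespace EvenClosedWalk

variable {G : SimpleGraph V}

/-- The `i`-th edge of the walk, as an element of the edge set of `G`. -/
def edge (w : EvenClosedWalk G) (i : ℕ) (h : i < 2 * w.q) : G.edgeSet :=
  ⟨s(w.verts i, w.verts (i + 1)), w.adj i h⟩

/-- The exponent vector `w⁺` of the monomial `E⁺(w)`, the product of the edges of `w`
in odd position (`1`-indexed). -/
def plusExp (w : EvenClosedWalk G) : G.edgeSet →₀ ℕ :=
  ∑ k : Fin w.q, Finsupp.single (w.edge (2 * (k : ℕ)) (by have := k.isLt; omega)) 1

/-- The exponent vector `w⁻` of the monomial `E⁻(w)`, the product of the edges of `w`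
in even position (`1`-indexed). -/
def minusExp (w : EvenClosedWalk G) : G.edgeSet →₀ ℕ :=
  ∑ k : Fin w.q, Finsupp.single (w.edge (2 * (k : ℕ) + 1) (by have := k.isLt; omega)) 1

end EvenClosedWalk

/-- The monomial `E⁺(w)`. -/
def Eplus (K : Type*) [Field K] {G : SimpleGraph V} (w : EvenClosedWalk G) :
    MvPolynomial G.edgeSet K :=
  monomial w.plusExp 1

/-- The monomial `E⁻(w)`. -/
def Eminus (K : Type*) [Field K] {G : SimpleGraph V} (w : EvenClosedWalk G) :
    MvPolynomial G.edgeSet K :=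
  monomial w.minusExp 1

/-- The binomial `B_w = E⁺(w) - E⁻(w)` of an even closed walk. -/
def Bw (K : Type*) [Field K] {G : SimpleGraph V} (w : EvenClosedWalk G) :
    MvPolynomial G.edgeSet K :=
  binom K w.plusExp w.minusExp

namespace EvenClosedWalk

variable {G : SimpleGraph V}

/-- The number of positions of the walk at which the edge `e` appears. -/
def count [DecidableEq V] (w : EvenClosedWalk G) (e : Sym2 V) : ℕ :=
  ((Finset.range (2 * w.q)).filter fun i => e = s(w.verts i, w.verts (i + 1))).card

/-- The subgraph `𝐰` of `G` spanned by the edges of the walk `w`. -/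
def graph (w : EvenClosedWalk G) : SimpleGraph V :=
  SimpleGraph.fromEdgeSet {e | ∃ i, ∃ _ : i < 2 * w.q, e = s(w.verts i, w.verts (i + 1))}

/-- The set `w⁺` of edges of `w` in odd position (`1`-indexed). -/
def plusEdges (w : EvenClosedWalk G) : Set (Sym2 V) :=
  {e | ∃ k, ∃ _ : k < w.q, e = s(w.verts (2 * k), w.verts (2 * k + 1))}

/-- The set `w⁻` of edges of `w` in even position (`1`-indexed). -/
def minusEdges (w : EvenClosedWalk G) : Set (Sym2 V) :=
  {e | ∃ k, ∃ _ : k < w.q, e = s(w.verts (2 * k + 1), w.verts (2 * k + 2))}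

/-- An even closed walk is primitive if it is nontrivial and there is no even closed
subwalk `ξ` of smaller length with `E⁺(ξ) ∣ E⁺(w)` and `E⁻(ξ) ∣ E⁻(w)`. -/
def IsPrimitive (w : EvenClosedWalk G) : Prop :=
  0 < w.q ∧ ∀ ξ : EvenClosedWalk G, 0 < ξ.q → ξ.q < w.q →
    ¬(ξ.plusExp ≤ w.plusExp ∧ ξ.minusExp ≤ w.minusExp)

/-- The walk `w` is a cycle: it visits no vertex twice. -/
def IsCycle (w : EvenClosedWalk G) : Prop :=
  2 ≤ w.q ∧ ∀ i j, i < 2 * w.q → j < 2 * w.q → w.verts i = w.verts j → i = j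

end EvenClosedWalk

/-! ### Cut vertices, cut edges, blocks, sinks -/

/-- `v` is a cut vertex of `H`: removing `v` (and the edges through it) disconnects two
vertices different from `v` that were connected in `H`. -/
def IsCutVertex (H : SimpleGraph V) (v : V) : Prop :=
  ∃ a b, a ≠ v ∧ b ≠ v ∧ H.Reachable a b ∧
    ¬(SimpleGraph.fromEdgeSet {e | e ∈ H.edgeSet ∧ v ∉ e}).Reachable a b

/-- `e` is a cut edge of `H`: removing it disconnects two vertices connected in `H`. -/
def IsCutEdge (H : SimpleGraph V) (e : Sym2 V) : Prop :=
  e ∈ H.edgeSet ∧ ∃ a b, H.Reachable a b ∧ ¬(H.deleteEdges {e}).Reachable a b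

/-- `H` is biconnected: it has an edge, it is connected (on its support),
and it has no cut vertex. -/
def IsBiconnected (H : SimpleGraph V) : Prop :=
  H.edgeSet.Nonempty ∧ (∀ a ∈ H.support, ∀ b ∈ H.support, H.Reachable a b) ∧
    ∀ v, ¬IsCutVertex H v

/-- `B` is a block of `H`: a maximal biconnected subgraph. -/
def IsBlock (H B : SimpleGraph V) : Prop :=
  B ≤ H ∧ IsBiconnected B ∧ ∀ B', B ≤ B' → B' ≤ H → IsBiconnected B' → B' = B

/-- A graph is a cycle (graph): its edge set is the edge set of a cycle of length `≥ 3`. -/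
def IsCycleGraph (B : SimpleGraph V) : Prop :=
  ∃ (n : ℕ) (f : ℕ → V), 3 ≤ n ∧
    (∀ i j, i < n → j < n → f i = f j → i = j) ∧
    B.edgeSet = {e | ∃ i, ∃ _ : i < n, e = s(f i, f ((i + 1) % n))}

/-- `v` is a sink of the block `B` of the walk `w`: a common vertex of two odd
(or two even) edges of the walk belonging to `B`. -/
def IsSinkOf {G : SimpleGraph V} (w : EvenClosedWalk G) (B : SimpleGraph V) (v : V) : Prop :=
  ∃ e₁ e₂ : Sym2 V, e₁ ≠ e₂ ∧ e₁ ∈ B.edgeSet ∧ e₂ ∈ B.edgeSet ∧ v ∈ e₁ ∧ v ∈ e₂ ∧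
    ((e₁ ∈ w.plusEdges ∧ e₂ ∈ w.plusEdges) ∨ (e₁ ∈ w.minusEdges ∧ e₂ ∈ w.minusEdges))

/-- `B` is a pure cyclic block of the walk `w`: a block of `𝐰` which is a cycle all of whose
edges lie in `w⁺`, or all in `w⁻`. -/
def IsPureCyclicBlock {G : SimpleGraph V} (w : EvenClosedWalk G) (B : SimpleGraph V) : Prop :=
  IsBlock w.graph B ∧ IsCycleGraph B ∧
    (B.edgeSet ⊆ w.plusEdges ∨ B.edgeSet ⊆ w.minusEdges)

/-- A primitive walk is mixed if it has no pure cyclic block. -/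
def EvenClosedWalk.IsMixed {G : SimpleGraph V} (w : EvenClosedWalk G) : Prop :=
  ∀ B : SimpleGraph V, ¬IsPureCyclicBlock w B

section AlternatingWalk

open Finset

/-- An alternating sum over consecutive pairs telescopes. -/
theorem sum_Ico_alternating_pair (f : ℕ → ℤ) {i j : ℕ} (h : i ≤ j) :
    ∑ t ∈ Ico i j, (-1) ^ t * (f t + f (t + 1)) = (-1) ^ i * f i - (-1) ^ j * f j := by
  induction j, h using Nat.le_induction with
  | base => simp
  | succ j h ih => rw [sum_Ico_succ_top h, ih, pow_succ]; ring

theorem neg_one_pow_eq_neg_of_mod_ne {i j : ℕ} (h : i % 2 ≠ j % 2) :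
    ((-1 : ℤ) ^ i) = -(-1) ^ j := by
  rw [neg_one_pow_eq_pow_mod_two i, neg_one_pow_eq_pow_mod_two j]
  rcases Nat.mod_two_eq_zero_or_one i with hi | hi <;>
    rcases Nat.mod_two_eq_zero_or_one j with hj | hj <;> simp_all

variable {W : Type*} [DecidableEq W]

/-- The indicator of the times at which a walk visits the vertex `x`. -/
def visit (p : ℕ → W) (x : W) (i : ℕ) : ℤ :=
  if p i = x then 1 else 0

/-- A set of steps of a walk is balanced if, at every vertex, its even-numbered and
odd-numbered steps have equally many ends. -/
def IsBalanced (p : ℕ → W) (S : Finset ℕ) : Prop :=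
  ∀ x, ∑ i ∈ S, (-1) ^ i * (visit p x i + visit p x (i + 1)) = 0

theorem isBalanced_Ico {p : ℕ → W} {i j : ℕ} (hij : i ≤ j) (hp : p i = p j)
    (hpar : i % 2 = j % 2) : IsBalanced p (Ico i j) := by
  intro x
  rw [sum_Ico_alternating_pair _ hij, neg_one_pow_eq_pow_mod_two i,
    neg_one_pow_eq_pow_mod_two j, hpar]
  simp [visit, hp]

theorem isBalanced_Ico_union_Ico {p : ℕ → W} {i k j l : ℕ} (hik : i ≤ k) (hkj : k ≤ j)
    (hjl : j ≤ l) (hij : p i = p j) (hkl : p k = p l) (hij' : i % 2 ≠ j % 2)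
    (hkl' : k % 2 ≠ l % 2) : IsBalanced p (Ico i k ∪ Ico j l) := by
  intro x
  rw [sum_union (Ico_disjoint_Ico_consecutive i k l |>.mono_right
      (Ico_subset_Ico_left hkj)), sum_Ico_alternating_pair _ hik,
    sum_Ico_alternating_pair _ hjl, neg_one_pow_eq_neg_of_mod_ne hij',
    neg_one_pow_eq_neg_of_mod_ne hkl']
  simp only [visit, hij, hkl]
  ring

/-- A closed walk of length `N` is balanced-minimal if consecutive vertices differ and its only
nonempty balanced set of steps is the set of all steps. -/
structure IsBalancedMinimal (p : ℕ → W) (N : ℕ) : Prop where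
  closed : p N = p 0
  ne_succ : ∀ i < N, p i ≠ p (i + 1)
  eq_range : ∀ S ⊆ range N, S.Nonempty → IsBalanced p S → S = range N

namespace IsBalancedMinimal

variable {p : ℕ → W} {N : ℕ}

theorem mod_two_ne (h : IsBalancedMinimal p N) {i j : ℕ} (hij : i < j) (hj : j ≤ N)
    (hne : 0 < i ∨ j < N) (hp : p i = p j) : i % 2 ≠ j % 2 := by
  intro hpar
  have hS := h.eq_range (Ico i j) (fun t ht => by simp at ht ⊢; omega)
    ⟨i, by simp [hij]⟩ (isBalanced_Ico hij.le hp hpar)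
  have h0 : 0 ∈ Ico i j := by rw [hS]; simp; omega
  have h1 : N - 1 ∈ Ico i j := by rw [hS]; simp; omega
  simp at h0 h1
  omega

theorem not_crossing (h : IsBalancedMinimal p N) {i k j l : ℕ} (hik : i < k) (hkj : k < j)
    (hjl : j < l) (hl : l ≤ N) (hij : p i = p j) : p k ≠ p l := by
  intro hkl
  have hS := h.eq_range (Ico i k ∪ Ico j l) (fun t ht => by simp at ht ⊢; omega)
    ⟨i, by simp [hik]⟩ (isBalanced_Ico_union_Ico hik.le hkj.le hjl.le hij hkl
      (h.mod_two_ne (hik.trans hkj) (by omega) (by omega) hij)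
      (h.mod_two_ne (hkj.trans hjl) hl (by omega) hkl))
  have hk : k ∈ Ico i k ∪ Ico j l := by rw [hS]; simp; omega
  simp at hk
  omega

/-- Between two visits to the same vertex there are two consecutive vertices which are
visited only once. -/
theorem exists_visited_once (h : IsBalancedMinimal p N) {i j : ℕ} (hij : i < j) (hj : j ≤ N)
    (hne : 0 < i ∨ j < N) (hp : p i = p j) :
    ∃ a, i < a ∧ a + 1 < j ∧ (∀ l < N, p l = p a → l = a) ∧
      ∀ l < N, p l = p (a + 1) → l = a + 1 := by
  induction hd : j - i using Nat.strong_induction_on generalizing i j with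
  | _ d ih =>
  by_cases hall : ∀ k, i < k → k < j → ∀ l < N, p l = p k → l = k
  · have hpar := h.mod_two_ne hij hj hne hp
    have h1 : j ≠ i + 1 := fun hj1 => h.ne_succ i (by omega) (hj1 ▸ hp)
    exact ⟨i + 1, by omega, by omega, hall _ (by omega) (by omega),
      hall _ (by omega) (by omega)⟩
  · push Not at hall
    obtain ⟨k, hik, hkj, l, hl, hlk, hne'⟩ := hall
    have hpar := h.mod_two_ne hij hj hne hp
    have hcase : ¬ (p k = p i) := fun hk => by
      have h1 := h.mod_two_ne hik (by omega) (by omega) hk.symm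
      have h2 := h.mod_two_ne hkj hj (by omega) (hk.trans hp)
      omega
    have hli : l ≠ i := by rintro rfl; exact hcase hlk.symm
    have hlj : l ≠ j := by rintro rfl; exact hcase (hlk.symm.trans hp.symm)
    rcases lt_or_gt_of_ne hli with hli | hli
    · exact absurd hp (h.not_crossing hli hik hkj hj hlk)
    rcases lt_or_gt_of_ne hlj with hlj | hlj
    · rcases lt_or_gt_of_ne hne' with hkl | hkl
      · obtain ⟨a, h1, h2, h3⟩ := ih (k - l) (by omega) hkl (by omega) (by omega) hlk rfl
        exact ⟨a, by omega, by omega, h3⟩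
      · obtain ⟨a, h1, h2, h3⟩ := ih (l - k) (by omega) hkl (by omega) (by omega) hlk.symm rfl
        exact ⟨a, by omega, by omega, h3⟩
    · exact absurd hlk.symm (h.not_crossing hik hkj hlj hl.le hp)

theorem card_visits_le_two (h : IsBalancedMinimal p N) (x : W) :
    ((range N).filter (p · = x)).card ≤ 2 := by
  by_contra! hcard
  obtain ⟨a, ha, b, hb, c, hc, hab, hac, hbc⟩ := two_lt_card.1 hcard
  simp only [mem_filter, mem_range] at ha hb hc
  have key : ∀ s t, s < N → t < N → p s = x → p t = x → s ≠ t → s % 2 ≠ t % 2 := by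
    intro s t hs ht hsx htx hst
    rcases lt_or_gt_of_ne hst with hst | hst
    · exact h.mod_two_ne hst ht.le (Or.inr ht) (hsx.trans htx.symm)
    · exact (h.mod_two_ne hst hs.le (Or.inr hs) (htx.trans hsx.symm)).symm
  have h1 := key a b ha.1 hb.1 ha.2 hb.2 hab
  have h2 := key a c ha.1 hc.1 ha.2 hc.2 hac
  have h3 := key b c hb.1 hc.1 hb.2 hc.2 hbc
  omega

/-- A balanced-minimal closed walk which returns to its starting vertex before its end has
length at most `2 * |W| - 4`. -/
theorem length_add_four_le [Fintype W] (h : IsBalancedMinimal p N) {j : ℕ} (hj0 : 0 < j)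
    (hjN : j < N) (hj : p j = p 0) : N + 4 ≤ 2 * Fintype.card W := by
  obtain ⟨a, -, ha, ha1, ha2⟩ := h.exists_visited_once hj0 hjN.le (Or.inr hjN) hj.symm
  obtain ⟨b, hb, hb', hb1, hb2⟩ :=
    h.exists_visited_once hjN le_rfl (Or.inl hj0) (hj.trans h.closed.symm)
  set T : Finset ℕ := {a, a + 1, b, b + 1} with hT
  have hTcard : T.card = 4 := by
    rw [hT, card_insert_of_notMem, card_insert_of_notMem, card_insert_of_notMem, card_singleton]
    all_goals simp; try omega
  have hTonce : ∀ t ∈ T, t < N ∧ ∀ l < N, p l = p t → l = t := by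
    intro t ht
    simp only [hT, mem_insert, mem_singleton] at ht
    rcases ht with rfl | rfl | rfl | rfl
    exacts [⟨by omega, ha1⟩, ⟨by omega, ha2⟩, ⟨by omega, hb1⟩, ⟨by omega, hb2⟩]
  have hfib : ∀ x, ((range N).filter (p · = x)).card + (T.filter (p · = x)).card ≤ 2 := by
    intro x
    rcases (T.filter (p · = x)).eq_empty_or_nonempty with he | ⟨t, ht⟩
    · simpa [he] using h.card_visits_le_two x
    · rw [mem_filter] at ht
      obtain ⟨htN, hto⟩ := hTonce t ht.1
      have hsub : ∀ U : Finset ℕ, (∀ l ∈ U, l < N) → (U.filter (p · = x)).card ≤ 1 := by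
        intro U hU
        refine (card_le_card (t := {t}) fun l hl => ?_).trans_eq (card_singleton t)
        rw [mem_filter] at hl
        exact mem_singleton.2 (hto l (hU l hl.1) (hl.2.trans ht.2.symm))
      have := hsub (range N) (fun l => mem_range.1)
      have := hsub T (fun l hl => (hTonce l hl).1)
      omega
  calc N + 4 = (range N).card + T.card := by rw [card_range, hTcard]
    _ = ∑ x, (((range N).filter (p · = x)).card + (T.filter (p · = x)).card) := by
      rw [sum_add_distrib, ← card_eq_sum_card_fiberwise (fun _ _ => mem_coe.2 (mem_univ _)),
        ← card_eq_sum_card_fiberwise (fun _ _ => mem_coe.2 (mem_univ _))]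
    _ ≤ ∑ _x : W, 2 := sum_le_sum fun x _ => hfib x
    _ = 2 * Fintype.card W := by simp [mul_comm]

end IsBalancedMinimal

end AlternatingWalk

section Binomials

variable {τ : Type*}

theorem support_binom (K : Type*) [Field K] {u v : τ →₀ ℕ} (h : u ≠ v) :
    ((binom K u v).support : Set (τ →₀ ℕ)) = {u, v} := by
  classical
  ext d
  simp only [binom, Finset.mem_coe, mem_support_iff, coeff_sub, coeff_monomial,
    Set.mem_insert_iff, Set.mem_singleton_iff]
  split_ifs with h1 h2 h2 <;> simp_all [eq_comm]

theorem totalDegree_binom (K : Type*) [Field K] {u v : τ →₀ ℕ} (h : u ≠ v)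
    (hdeg : u.degree = v.degree) : (binom K u v).totalDegree = u.degree := by
  apply le_antisymm
  · refine (totalDegree_sub _ _).trans ?_
    rw [totalDegree_monomial _ one_ne_zero, totalDegree_monomial _ one_ne_zero]
    exact max_le le_rfl hdeg.ge
  · have hu : u ∈ (binom K u v).support := by
      rw [← Finset.mem_coe, support_binom K h]; simp
    exact le_totalDegree hu

theorem mem_vars_binom (K : Type*) [Field K] {u v : τ →₀ ℕ} (h : u ≠ v) {e : τ} :
    e ∈ (binom K u v).vars ↔ u e ≠ 0 ∨ v e ≠ 0 := by
  simp_rw [mem_vars_iff_mem_support, ← Finset.mem_coe (s := (binom K u v).support),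
    support_binom K h]
  simp

/-- A binomial with coprime terms, one of which is linear in some variable, is irreducible. -/
theorem irreducible_binom (K : Type*) [Field K] {u v : τ →₀ ℕ}
    (hdisj : Disjoint u.support v.support) {e : τ} (he : u e = 1) :
    Irreducible (binom K u v) := by
  have hne : u ≠ v := by
    rintro rfl
    rw [disjoint_self, Finset.bot_eq_empty] at hdisj
    simp_all
  have hu : u ∈ (binom K u v).support := by
    rw [← Finset.mem_coe, support_binom K hne]; simp
  refine irreducible_of_disjoint_support ⟨u, hu, v, ?_, hne⟩ hu he ?_ fun r hr => ?_
  · rw [support_binom K hne]; simp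
  · rw [support_binom K hne]
    exact Set.pairwise_pair.2 fun _ => ⟨hdisj, hdisj.symm⟩
  · exact isUnit_of_dvd_unit (hr u) (isUnit_iff_ne_zero.2 (mem_support_iff.1 hu))

end Binomials

section VertexDegree

variable {W : Type*} {G : SimpleGraph W}

/-- The exponent vector of the image of an edge. -/
def edgeVector (e : Sym2 W) : W →₀ ℕ :=
  Sym2.lift ⟨fun a b => Finsupp.single a 1 + Finsupp.single b 1, fun _ _ => add_comm _ _⟩ e

theorem edgeVector_mk (a b : W) :
    edgeVector s(a, b) = Finsupp.single a 1 + Finsupp.single b 1 := rfl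

theorem degree_edgeVector (e : Sym2 W) : (edgeVector e).degree = 2 := by
  induction e with
  | _ a b => simp [edgeVector_mk]

theorem edgeImage_eq_monomial (K : Type*) [Field K] (e : Sym2 W) :
    edgeImage K e = monomial (edgeVector e) 1 := by
  induction e with
  | _ a b => simp [edgeVector_mk, edgeImage, X, monomial_mul]

/-- The exponent vector, in the vertex variables, of the image of an edge monomial; its value at a
vertex is the number of ends of edges at this vertex. -/
def vertexDegree (G : SimpleGraph W) : (G.edgeSet →₀ ℕ) →ₗ[ℕ] (W →₀ ℕ) :=
  Finsupp.linearCombination ℕ fun e => edgeVector (e : Sym2 W)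

theorem vertexDegree_single (e : G.edgeSet) :
    vertexDegree G (Finsupp.single e 1) = edgeVector (e : Sym2 W) := by
  simp [vertexDegree]

theorem degree_vertexDegree (u : G.edgeSet →₀ ℕ) :
    (vertexDegree G u).degree = 2 * u.degree := by
  induction u using Finsupp.induction_linear with
  | zero => simp
  | add u v hu hv => simp only [map_add, hu, hv]; ring
  | single e k =>
    rw [← mul_one k, ← smul_eq_mul, ← Finsupp.smul_single, map_smul, vertexDegree_single,
      map_nsmul, map_nsmul, degree_edgeVector, Finsupp.degree_single]
    simp [mul_comm]

theorem degree_eq_of_vertexDegree_eq {u v : G.edgeSet →₀ ℕ}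
    (h : vertexDegree G u = vertexDegree G v) : u.degree = v.degree := by
  have := congrArg Finsupp.degree h
  rw [degree_vertexDegree, degree_vertexDegree] at this
  omega

theorem vertexDegree_apply [Fintype G.edgeSet] (u : G.edgeSet →₀ ℕ) (x : W) :
    vertexDegree G u x = ∑ e, u e * edgeVector (e : Sym2 W) x := by
  rw [vertexDegree, Finsupp.linearCombination_apply, Finsupp.sum_fintype _ _ (by simp),
    Finsupp.finsetSum_apply]
  simp

theorem binom_mem_graphToricIdeal (K : Type*) [Field K] {u v : G.edgeSet →₀ ℕ} :
    binom K u v ∈ graphToricIdeal K G ↔ vertexDegree G u = vertexDegree G v := by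
  have himage : ∀ w : G.edgeSet →₀ ℕ,
      aeval (fun e : G.edgeSet => edgeImage K (e : Sym2 W)) (monomial w (1 : K)) =
        monomial (vertexDegree G w) 1 := by
    intro w
    rw [aeval_monomial, vertexDegree, Finsupp.linearCombination_apply,
      monomial_finsupp_sum_index]
    simp [edgeImage_eq_monomial, monomial_pow]
  change aeval (fun e : G.edgeSet => edgeImage K (e : Sym2 W)) (binom K u v) = 0 ↔ _
  rw [binom, map_sub, himage, himage, sub_eq_zero,
    (monomial_left_injective (one_ne_zero : (1 : K) ≠ 0)).eq_iff]

end VertexDegree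

section PrimitivePair

open Finset

variable {W : Type*} {G : SimpleGraph W}

/-- The exponent vector of the product of the edges at those positions of `S` which are congruent
to `r` modulo `2`. -/
def stepExp (ed : ℕ → G.edgeSet) (S : Finset ℕ) (r : ℕ) : G.edgeSet →₀ ℕ :=
  ∑ i ∈ S with i % 2 = r, Finsupp.single (ed i) 1

theorem stepExp_mono (ed : ℕ → G.edgeSet) {S T : Finset ℕ} (h : S ⊆ T) (r : ℕ) :
    stepExp ed S r ≤ stepExp ed T r :=
  sum_le_sum_of_subset (filter_subset_filter _ h)

theorem stepExp_congr {ed ed' : ℕ → G.edgeSet} {S : Finset ℕ} (h : ∀ i ∈ S, ed i = ed' i) (r : ℕ) :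
    stepExp ed S r = stepExp ed' S r :=
  sum_congr rfl fun i hi => by rw [h i (mem_filter.1 hi).1]

theorem stepExp_range_succ (ed : ℕ → G.edgeSet) (L r : ℕ) :
    stepExp ed (range (L + 1)) r =
      stepExp ed (range L) r + if L % 2 = r then Finsupp.single (ed L) 1 else 0 := by
  rw [stepExp, stepExp, sum_filter, sum_range_succ, ← sum_filter]

theorem degree_stepExp_add (ed : ℕ → G.edgeSet) (S : Finset ℕ) :
    (stepExp ed S 0).degree + (stepExp ed S 1).degree = S.card := by
  have h : ∀ r, (stepExp ed S r).degree = (S.filter (· % 2 = r)).card := fun r => by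
    rw [stepExp, map_sum]
    simp
  rw [h, h, ← card_filter_add_card_filter_not (s := S) (fun i => i % 2 = 0)]
  simp

theorem vertexDegree_mono {w u : G.edgeSet →₀ ℕ} (h : w ≤ u) :
    vertexDegree G w ≤ vertexDegree G u := by
  obtain ⟨d, rfl⟩ := exists_add_of_le h
  rw [map_add]
  exact le_self_add

/-- The pairs of exponent vectors of primitive binomials. -/
structure IsPrimitivePair (u v : G.edgeSet →₀ ℕ) : Prop where
  ne : u ≠ v
  vertexDegree_eq : vertexDegree G u = vertexDegree G v
  eq_of_le : ∀ w z : G.edgeSet →₀ ℕ, w ≠ z → vertexDegree G w = vertexDegree G z →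
    w ≤ u → z ≤ v → w = u ∧ z = v

theorem isPrimitiveBinomial_iff (K : Type*) [Field K] {f : MvPolynomial G.edgeSet K} :
    IsPrimitiveBinomial (graphToricIdeal K G) f ↔
      ∃ u v, IsPrimitivePair u v ∧ f = binom K u v := by
  constructor
  · rintro ⟨u, v, hne, rfl, hmem, hmin⟩
    simp only [binom_mem_graphToricIdeal] at hmem hmin
    exact ⟨u, v, ⟨hne, hmem, hmin⟩, rfl⟩
  · rintro ⟨u, v, h, rfl⟩
    refine ⟨u, v, h.ne, rfl, ?_⟩
    simp only [binom_mem_graphToricIdeal]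
    exact ⟨h.vertexDegree_eq, h.eq_of_le⟩

theorem IsPrimitivePair.eq_zero_of_le {u v w : G.edgeSet →₀ ℕ} (h : IsPrimitivePair u v)
    (hu : w ≤ u) (hv : w ≤ v) : w = 0 := by
  obtain ⟨u', rfl⟩ := exists_add_of_le hu
  obtain ⟨v', rfl⟩ := exists_add_of_le hv
  have hdeg := h.vertexDegree_eq
  rw [map_add, map_add] at hdeg
  have := (h.eq_of_le u' v' (fun he => h.ne (by rw [he])) (add_left_cancel hdeg)
    le_add_self le_add_self).1
  simpa using this

variable [DecidableEq W]

theorem vertexDegree_stepExp {p : ℕ → W} {ed : ℕ → G.edgeSet} {S : Finset ℕ}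
    (h : ∀ i ∈ S, (ed i : Sym2 W) = s(p i, p (i + 1))) (r : ℕ) (x : W) :
    (vertexDegree G (stepExp ed S r) x : ℤ) =
      ∑ i ∈ S with i % 2 = r, (visit p x i + visit p x (i + 1)) := by
  rw [stepExp, map_sum, Finsupp.finsetSum_apply, Nat.cast_sum]
  refine sum_congr rfl fun i hi => ?_
  rw [vertexDegree_single, h i (mem_filter.1 hi).1, edgeVector_mk]
  simp [visit, Finsupp.single_apply]

theorem vertexDegree_stepExp_sub {p : ℕ → W} {ed : ℕ → G.edgeSet} {S : Finset ℕ}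
    (h : ∀ i ∈ S, (ed i : Sym2 W) = s(p i, p (i + 1))) (x : W) :
    (vertexDegree G (stepExp ed S 0) x : ℤ) - vertexDegree G (stepExp ed S 1) x =
      ∑ i ∈ S, (-1) ^ i * (visit p x i + visit p x (i + 1)) := by
  rw [vertexDegree_stepExp h, vertexDegree_stepExp h, sum_filter, sum_filter, ← sum_sub_distrib]
  refine sum_congr rfl fun i _ => ?_
  rw [neg_one_pow_eq_pow_mod_two]
  rcases Nat.mod_two_eq_zero_or_one i with hi | hi <;> simp [hi]

theorem isBalanced_iff {p : ℕ → W} {ed : ℕ → G.edgeSet} {S : Finset ℕ}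
    (h : ∀ i ∈ S, (ed i : Sym2 W) = s(p i, p (i + 1))) :
    IsBalanced p S ↔
      vertexDegree G (stepExp ed S 0) = vertexDegree G (stepExp ed S 1) := by
  simp_rw [IsBalanced, ← vertexDegree_stepExp_sub h, sub_eq_zero, Nat.cast_inj, Finsupp.ext_iff]

theorem exists_mem_lt_of_vertexDegree_lt [Finite W] {w u : G.edgeSet →₀ ℕ} {x : W}
    (h : vertexDegree G w x < vertexDegree G u x) :
    ∃ e : G.edgeSet, x ∈ (e : Sym2 W) ∧ w e < u e := by
  by_contra! hle
  have := Fintype.ofFinite G.edgeSet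
  refine h.not_ge ?_
  rw [vertexDegree_apply, vertexDegree_apply]
  refine sum_le_sum fun e _ => ?_
  by_cases hx : x ∈ (e : Sym2 W)
  · exact Nat.mul_le_mul_right _ (hle e hx)
  · obtain ⟨⟨a, b⟩, he⟩ := e
    have hx' : a ≠ x ∧ b ≠ x := by
      rw [← not_or]
      rintro (rfl | rfl)
      exacts [hx (Sym2.mem_mk_left _ _), hx (Sym2.mem_mk_right _ _)]
    have : edgeVector s(a, b) x = 0 := by simp [edgeVector_mk, hx'.1, hx'.2]
    exact (by simp [this] : u ⟨s(a, b), he⟩ * edgeVector s(a, b) x = 0).trans_le (Nat.zero_le _)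

/-- An alternating walk of length `L` starting at `x` whose even-numbered and odd-numbered steps
(counted from `0`) have multiplicities bounded by `c 0` and `c 1`. -/
structure IsAlternatingTrail (c : ℕ → G.edgeSet →₀ ℕ) (x : W) (L : ℕ) (p : ℕ → W)
    (ed : ℕ → G.edgeSet) : Prop where
  start : p 0 = x
  step : ∀ i < L, (ed i : Sym2 W) = s(p i, p (i + 1))
  le : ∀ r < 2, stepExp ed (range L) r ≤ c r

theorem IsAlternatingTrail.exists_succ [Finite W] {c : ℕ → G.edgeSet →₀ ℕ} {x : W} {L : ℕ}
    {p : ℕ → W} {ed : ℕ → G.edgeSet} (h : IsAlternatingTrail c x L p ed)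
    (hc : vertexDegree G (c 0) = vertexDegree G (c 1)) (hx : 0 < vertexDegree G (c 0) x)
    (hopen : ¬(0 < L ∧ L % 2 = 0 ∧ p L = x)) :
    ∃ p' ed', IsAlternatingTrail c x (L + 1) p' ed' := by
  have hbal := vertexDegree_stepExp_sub (S := range L) (fun i hi => h.step i (mem_range.1 hi)) (p L)
  rw [range_eq_Ico, sum_Ico_alternating_pair _ (Nat.zero_le L), ← range_eq_Ico] at hbal
  have hle0 := vertexDegree_mono (h.le 0 (by norm_num)) (p L)
  have hle1 := vertexDegree_mono (h.le 1 (by norm_num)) (p L)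
  have hceq := DFunLike.congr_fun hc (p L)
  have hlt : vertexDegree G (stepExp ed (range L) (L % 2)) (p L) <
      vertexDegree G (c (L % 2)) (p L) := by
    rw [neg_one_pow_eq_pow_mod_two L] at hbal
    simp only [visit, h.start, if_true, pow_zero, one_mul, mul_one] at hbal
    rcases Nat.mod_two_eq_zero_or_one L with hL | hL
    · rw [hL] at hbal ⊢
      by_cases hpx : x = p L
      · obtain rfl : L = 0 := by
          by_contra h0
          exact hopen ⟨by omega, hL, hpx.symm⟩
        simpa [stepExp, h.start] using hx
      · rw [if_neg hpx] at hbal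
        simp at hbal
        omega
    · rw [hL] at hbal ⊢
      split_ifs at hbal <;> simp at hbal <;> omega
  obtain ⟨e, hmem, he⟩ := exists_mem_lt_of_vertexDegree_lt hlt
  obtain ⟨y, hy⟩ := hmem
  have hexp : ∀ r, stepExp (Function.update ed L e) (range L) r = stepExp ed (range L) r :=
    stepExp_congr fun i hi => Function.update_of_ne (mem_range.1 hi).ne _ _
  refine ⟨Function.update p (L + 1) y, Function.update ed L e, ?_, ?_, ?_⟩
  · rw [Function.update_of_ne (by omega), h.start]
  · intro i hi
    rw [Function.update_of_ne (by omega : i ≠ L + 1)]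
    rcases (Nat.lt_succ_iff_lt_or_eq.1 hi) with hi | rfl
    · rw [Function.update_of_ne hi.ne, Function.update_of_ne (by omega), h.step i hi]
    · rw [Function.update_self, Function.update_self, hy]
  · intro r hr
    rw [stepExp_range_succ, hexp, Function.update_self]
    split_ifs with hLr
    · subst hLr
      intro f
      rw [Finsupp.add_apply]
      by_cases hf : e = f
      · subst hf
        simpa using he
      · simpa [hf] using h.le _ hr f
    · simpa using h.le r hr

/-- Every vertex of positive degree is on a closed alternating trail. -/
theorem exists_closed_alternatingTrail [Finite W] {c : ℕ → G.edgeSet →₀ ℕ} {x : W}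
    (hc : vertexDegree G (c 0) = vertexDegree G (c 1)) (hx : 0 < vertexDegree G (c 0) x) :
    ∃ L p ed, IsAlternatingTrail c x L p ed ∧ 0 < L ∧ L % 2 = 0 ∧ p L = x := by
  by_contra! hno
  have hall : ∀ L, ∃ p ed, IsAlternatingTrail c x L p ed := by
    intro L
    induction L with
    | zero =>
      obtain ⟨e, -⟩ := exists_mem_lt_of_vertexDegree_lt (w := 0) (u := c 0) (x := x) (by simpa)
      exact ⟨fun _ => x, fun _ => e, rfl, by simp, fun r _ => by simp [stepExp]⟩
    | succ L ih =>
      obtain ⟨p, ed, h⟩ := ih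
      exact h.exists_succ hc hx fun hcl => hno L p ed h hcl.1 hcl.2.1 hcl.2.2
  obtain ⟨p, ed, h⟩ := hall ((c 0).degree + (c 1).degree + 1)
  have h0 := Finsupp.degree_mono (h.le 0 (by norm_num))
  have h1 := Finsupp.degree_mono (h.le 1 (by norm_num))
  have h2 := degree_stepExp_add ed (range ((c 0).degree + (c 1).degree + 1))
  rw [card_range] at h2
  omega

theorem IsPrimitivePair.isBalancedMinimal {u v : G.edgeSet →₀ ℕ} (h : IsPrimitivePair u v)
    {c : ℕ → G.edgeSet →₀ ℕ} (hc0 : c 0 = u) (hc1 : c 1 = v) {x : W} {L : ℕ} {p : ℕ → W}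
    {ed : ℕ → G.edgeSet} (htrail : IsAlternatingTrail c x L p ed) (hL : 0 < L) (hL2 : L % 2 = 0)
    (hclosed : p L = x) :
    IsBalancedMinimal p L ∧ stepExp ed (range L) 0 = u ∧ stepExp ed (range L) 1 = v := by
  have hclosed' : p L = p 0 := hclosed.trans htrail.start.symm
  have hsub : ∀ S ⊆ range L, S.Nonempty → IsBalanced p S →
      stepExp ed S 0 = u ∧ stepExp ed S 1 = v := by
    intro S hS hne hbal
    have h0 : stepExp ed S 0 ≤ u :=
      (stepExp_mono ed hS 0).trans ((htrail.le 0 (by norm_num)).trans_eq hc0)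
    have h1 : stepExp ed S 1 ≤ v :=
      (stepExp_mono ed hS 1).trans ((htrail.le 1 (by norm_num)).trans_eq hc1)
    refine h.eq_of_le _ _ (fun heq => ?_)
      ((isBalanced_iff fun i hi => htrail.step i (mem_range.1 (hS hi))).1 hbal) h0 h1
    have hz := h.eq_zero_of_le h0 (heq.trans_le h1)
    have hcard := degree_stepExp_add ed S
    rw [← heq, hz] at hcard
    have := hne.card_pos
    simp at hcard
    omega
  have hrange := hsub (range L) subset_rfl ⟨0, by simpa⟩
    (by
      rw [range_eq_Ico]
      exact isBalanced_Ico hL.le hclosed'.symm hL2.symm)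
  refine ⟨⟨hclosed', fun i hi => ?_, fun S hS hne hbal => ?_⟩, hrange⟩
  · have := (ed i).2
    rw [htrail.step i hi, SimpleGraph.mem_edgeSet] at this
    exact this.ne
  · refine eq_of_subset_of_card_le hS ?_
    have h0 := hsub S hS hne hbal
    rw [← degree_stepExp_add ed S, ← degree_stepExp_add ed (range L), h0.1, h0.2, hrange.1,
      hrange.2]

/-- The terms of a primitive binomial of the toric ideal of a graph on at least four vertices
have degree at most the number of vertices minus two. -/
theorem IsPrimitivePair.degree_add_two_le [Fintype W] {u v : G.edgeSet →₀ ℕ}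
    (h : IsPrimitivePair u v) (hW : 4 ≤ Fintype.card W) : u.degree + 2 ≤ Fintype.card W := by
  by_cases hsmall : ∀ x, vertexDegree G u x ≤ 1
  · have hsum := degree_vertexDegree u
    rw [Finsupp.degree_eq_sum] at hsum
    have := (sum_le_sum fun x (_ : x ∈ univ) => hsmall x).trans_eq (by simp : _ = Fintype.card W)
    omega
  · push Not at hsmall
    obtain ⟨x, hx⟩ := hsmall
    obtain ⟨L, p, ed, htrail, hL, hL2, hclosed⟩ :=
      exists_closed_alternatingTrail (c := fun r => if r = 0 then u else v) (x := x)
        (by simpa using h.vertexDegree_eq) (by simp; omega)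
    obtain ⟨hmin, h0, h1⟩ := h.isBalancedMinimal (by simp) (by simp) htrail hL hL2 hclosed
    have hlen : 2 * u.degree = L := by
      have := degree_stepExp_add ed (range L)
      rw [h0, h1, ← degree_eq_of_vertexDegree_eq h.vertexDegree_eq, card_range] at this
      omega
    suffices ∃ j, 0 < j ∧ j < L ∧ p j = p 0 by
      obtain ⟨j, hj0, hjL, hj⟩ := this
      have := hmin.length_add_four_le hj0 hjL hj
      omega
    by_contra! hno
    have hvisit : ∀ i, 0 < i → i < L → visit p x i = 0 := fun i hi0 hiL =>
      if_neg fun hi => hno i hi0 hiL (hi.trans htrail.start.symm)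
    have hx' := vertexDegree_stepExp (fun i hi => htrail.step i (mem_range.1 hi)) 0 x
    rw [h0, sum_eq_single_of_mem 0 (by simpa) fun i hi hi0 => ?_, hvisit (0 + 1) (by omega) (by omega),
      visit, if_pos htrail.start] at hx'
    · omega
    · simp only [mem_filter, mem_range] at hi
      rw [hvisit i (by omega) hi.1, hvisit (i + 1) (by omega) (by omega), add_zero]

end PrimitivePair

section Circuit

open Finset

variable {W : Type*} {G : SimpleGraph W}

/-- A pair of exponent vectors with disjoint supports, one entry of which is `1`, spanning up to
scalars the kernel of the vertex degree map on its support. -/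
structure IsRigidPair [Fintype G.edgeSet] (u v : G.edgeSet →₀ ℕ) (e₀ : G.edgeSet) : Prop where
  disjoint : ∀ e, u e = 0 ∨ v e = 0
  apply_eq_one : u e₀ = 1
  vertexDegree_eq : vertexDegree G u = vertexDegree G v
  eq_zero : ∀ y : G.edgeSet → ℤ, (∀ x, ∑ e, y e * (edgeVector (e : Sym2 W) x : ℤ) = 0) →
    (∀ e, y e ≠ 0 → u e ≠ 0 ∨ v e ≠ 0) → y e₀ = 0 → y = 0

namespace IsRigidPair

variable [Fintype G.edgeSet] {u v : G.edgeSet →₀ ℕ} {e₀ : G.edgeSet}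

theorem ne (h : IsRigidPair u v e₀) : u ≠ v := by
  rintro rfl
  have h0 := h.disjoint e₀
  have h1 := h.apply_eq_one
  omega

theorem sub_eq_mul (h : IsRigidPair u v e₀) {w z : G.edgeSet →₀ ℕ}
    (hwz : vertexDegree G w = vertexDegree G z)
    (hsupp : ∀ e, w e ≠ 0 ∨ z e ≠ 0 → u e ≠ 0 ∨ v e ≠ 0) (e : G.edgeSet) :
    (w e : ℤ) - z e = (w e₀ - z e₀) * (u e - v e) := by
  have hker : ∀ {w z : G.edgeSet →₀ ℕ}, vertexDegree G w = vertexDegree G z → ∀ x,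
      ∑ e, ((w e : ℤ) - z e) * (edgeVector (e : Sym2 W) x : ℤ) = 0 := by
    intro w z hwz x
    have := DFunLike.congr_fun hwz x
    rw [vertexDegree_apply, vertexDegree_apply] at this
    simp_rw [sub_mul, sum_sub_distrib]
    rw [sub_eq_zero]
    exact_mod_cast this
  have hv : v e₀ = 0 := by
    have h0 := h.disjoint e₀
    have h1 := h.apply_eq_one
    omega
  have := congrFun (h.eq_zero
    (fun e => ((w e : ℤ) - z e) - (w e₀ - z e₀) * (u e - v e)) (fun x => ?_) (fun e he => ?_)
    (by simp [h.apply_eq_one, hv])) e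
  · exact sub_eq_zero.1 this
  · simp_rw [sub_mul _ _ (Nat.cast _ : ℤ), sum_sub_distrib, mul_assoc, ← mul_sum]
    have h1 := hker hwz x
    have h2 := hker h.vertexDegree_eq x
    simp_rw [sub_mul, sum_sub_distrib] at h1 h2
    simp_rw [sub_mul, sum_sub_distrib]
    rw [h1, h2]
    simp
  · by_contra hcon
    have := mt (hsupp e) hcon
    refine he ?_
    have hu : u e = 0 := by omega
    have hv : v e = 0 := by omega
    have hw : w e = 0 := by omega
    have hz : z e = 0 := by omega
    simp [hu, hv, hw, hz]

theorem isPrimitivePair (h : IsRigidPair u v e₀) : IsPrimitivePair u v := by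
  refine ⟨h.ne, h.vertexDegree_eq, fun w z hne hwz hwu hzv => ?_⟩
  have hmul := h.sub_eq_mul hwz fun e he => by
    have := hwu e
    have := hzv e
    omega
  have hw0 := hwu e₀
  have hz0 := hzv e₀
  have h1 := h.apply_eq_one
  have hd := h.disjoint e₀
  have hcase : (w e₀ : ℤ) - z e₀ = 0 ∨ (w e₀ : ℤ) - z e₀ = 1 := by omega
  rcases hcase with h0 | h0
  · refine absurd (Finsupp.ext fun e => ?_) hne
    have := hmul e
    rw [h0, zero_mul] at this
    omega
  · rw [h0] at hmul
    constructor <;> ext e <;>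
    · have := hmul e
      have := hwu e
      have := hzv e
      have := h.disjoint e
      omega

theorem isCircuitBinomial (K : Type*) [Field K] (h : IsRigidPair u v e₀) :
    IsCircuitBinomial (graphToricIdeal K G) (binom K u v) := by
  refine ⟨⟨u, v, h.ne, rfl⟩, (binom_mem_graphToricIdeal K).2 h.vertexDegree_eq,
    irreducible_binom K (e := e₀) ?_ h.apply_eq_one, ?_⟩
  · rw [Finset.disjoint_left]
    intro e
    rw [Finsupp.mem_support_iff, Finsupp.mem_support_iff]
    have := h.disjoint e
    omega
  · rintro _ ⟨w, z, hne, rfl⟩ hmem hsub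
    refine hsub.antisymm fun e he => ?_
    have hmul := h.sub_eq_mul ((binom_mem_graphToricIdeal K).1 hmem) fun e he =>
      (mem_vars_binom K h.ne).1 (hsub ((mem_vars_binom K hne).2 he))
    have ht : (w e₀ : ℤ) - z e₀ ≠ 0 := fun h0 => hne <| Finsupp.ext fun e => by
      have := hmul e
      rw [h0, zero_mul] at this
      omega
    rw [mem_vars_binom K h.ne] at he
    rw [mem_vars_binom K hne]
    have hd := h.disjoint e
    have huv : (u e : ℤ) - v e ≠ 0 := by omega
    have := hmul e ▸ mul_ne_zero ht huv
    omega

end IsRigidPair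

theorem sum_neighbors_eq [Fintype W] [DecidableEq W] [Fintype G.edgeSet] (y : G.edgeSet → ℤ)
    (Y : Sym2 W → ℤ) (hY : ∀ e : G.edgeSet, Y e = y e) (hY' : ∀ s, s ∉ G.edgeSet → Y s = 0)
    (a : W) : ∑ b, Y s(a, b) = ∑ e, y e * (edgeVector (e : Sym2 W) a : ℤ) := by
  have h1 : ∀ b, Y s(a, b) = ∑ e : G.edgeSet, if (e : Sym2 W) = s(a, b) then y e else 0 := by
    intro b
    by_cases hab : s(a, b) ∈ G.edgeSet
    · rw [sum_eq_single (⟨s(a, b), hab⟩ : G.edgeSet) (fun e _ he => ?_) (by simp), if_pos rfl]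
      · exact hY ⟨_, hab⟩
      · exact if_neg fun h => he (Subtype.ext h)
    · rw [hY' _ hab, sum_eq_zero fun e _ => if_neg ?_]
      rintro h
      exact hab (h ▸ e.2)
  simp_rw [h1]
  rw [sum_comm]
  refine sum_congr rfl fun e _ => ?_
  obtain ⟨⟨c, d⟩, he⟩ := e
  have hcd : c ≠ d := G.ne_of_adj he
  change ∑ b, (if s(c, d) = s(a, b) then _ else 0) = _ * ((edgeVector s(c, d) a : ℕ) : ℤ)
  rw [edgeVector_mk, ← sum_filter, sum_const, nsmul_eq_mul, mul_comm]
  congr 1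
  rw [Nat.cast_inj]
  by_cases hc : c = a
  · subst hc
    rw [show univ.filter (fun b => s(c, d) = s(c, b)) = {d} by ext b; simp; grind]
    simp [hcd.symm]
  · by_cases hd : d = a
    · subst hd
      rw [show univ.filter (fun b => s(c, d) = s(d, b)) = {c} by ext b; simp [hc, eq_comm]]
      simp [hc]
    · rw [show univ.filter (fun b => s(c, d) = s(a, b)) = ∅ by ext b; simp [hc, hd]]
      simp [hc, hd]

end Circuit

section TrianglesWalk

open Finset

/-- The closed walk `0, 1, 2, …, n - 1, n - 3, n - 4, …, 2, 0` of length `2 * n - 4`, consisting of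
two triangles joined by a path when `4 < n`, and of a four-cycle when `n = 4`. -/
def trianglesWalk (n i : ℕ) : ℕ :=
  if i < n then i else if i < 2 * n - 4 then 2 * n - 3 - i else 0

theorem trianglesWalk_cases (n i : ℕ) : i < n ∧ trianglesWalk n i = i ∨
    n ≤ i ∧ i < 2 * n - 4 ∧ trianglesWalk n i = 2 * n - 3 - i ∨
      n ≤ i ∧ 2 * n - 4 ≤ i ∧ trianglesWalk n i = 0 := by
  unfold trianglesWalk
  split_ifs <;> omega

theorem trianglesWalk_lt {n : ℕ} (hn : 4 ≤ n) (i : ℕ) : trianglesWalk n i < n := by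
  unfold trianglesWalk
  split_ifs <;> omega

theorem trianglesWalk_ne_succ {n i : ℕ} (hn : 4 ≤ n) (hi : i < 2 * n - 4) :
    trianglesWalk n i ≠ trianglesWalk n (i + 1) := by
  unfold trianglesWalk
  split_ifs <;> omega

theorem trianglesWalk_eq_zero_one {n i : ℕ} (hn : 4 ≤ n) (hi : i < 2 * n - 4)
    (h : trianglesWalk n i = 0 ∧ trianglesWalk n (i + 1) = 1 ∨
      trianglesWalk n i = 1 ∧ trianglesWalk n (i + 1) = 0) : i = 0 := by
  have hi0 := trianglesWalk_cases n i
  have hi1 := trianglesWalk_cases n (i + 1)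
  omega

theorem trianglesWalk_mod_two_eq {n i j : ℕ} (hn : 4 ≤ n) (hi : i < 2 * n - 4)
    (hj : j < 2 * n - 4)
    (h : trianglesWalk n i = trianglesWalk n j ∧
        trianglesWalk n (i + 1) = trianglesWalk n (j + 1) ∨
      trianglesWalk n i = trianglesWalk n (j + 1) ∧
        trianglesWalk n (i + 1) = trianglesWalk n j) : i % 2 = j % 2 := by
  have hi0 := trianglesWalk_cases n i
  have hi1 := trianglesWalk_cases n (i + 1)
  have hj0 := trianglesWalk_cases n j
  have hj1 := trianglesWalk_cases n (j + 1)
  omega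

theorem trianglesWalk_step {n i a b : ℕ} (hn : 4 ≤ n) (hi : i < 2 * n - 4)
    (h : a = trianglesWalk n i ∧ b = trianglesWalk n (i + 1) ∨
      a = trianglesWalk n (i + 1) ∧ b = trianglesWalk n i) :
    b = a + 1 ∨ a = b + 1 ∨
      (if n = 4 then a = 0 ∧ b = 3 ∨ a = 3 ∧ b = 0
      else a = 0 ∧ b = 2 ∨ a = 2 ∧ b = 0 ∨ a = n - 3 ∧ b = n - 1 ∨ a = n - 1 ∧ b = n - 3) := by
  unfold trianglesWalk at h
  split_ifs at h ⊢ <;> omega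

/-- A weighting of the edges of `trianglesWalk n` with zero sum at every vertex vanishes as soon as
it vanishes on one edge of the first triangle. -/
theorem eq_zero_of_sum_eq_zero {n : ℕ} (hn : 4 ≤ n) (Y : ℕ → ℕ → ℤ)
    (hsymm : ∀ a b, Y a b = Y b a) (hsum : ∀ a < n, ∑ b ∈ range n, Y a b = 0)
    (hsupp : ∀ a < n, ∀ b < n, Y a b ≠ 0 → b = a + 1 ∨ a = b + 1 ∨
      (if n = 4 then a = 0 ∧ b = 3 ∨ a = 3 ∧ b = 0
      else a = 0 ∧ b = 2 ∨ a = 2 ∧ b = 0 ∨ a = n - 3 ∧ b = n - 1 ∨ a = n - 1 ∧ b = n - 3))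
    (h01 : Y 0 1 = 0) : ∀ a < n, ∀ b < n, Y a b = 0 := by
  have row : ∀ a c d, a < n → c < n → d < n → c ≠ d →
      (∀ b < n, b ≠ c → b ≠ d → Y a b = 0) → Y a c + Y a d = 0 := by
    intro a c d ha hc hd hcd hz
    rw [← hsum a ha]
    exact (sum_eq_add_of_mem c d (by simpa) (by simpa) hcd fun b hb hne =>
      hz b (by simpa using hb) hne.1 hne.2).symm
  rcases hn.eq_or_lt with rfl | hn
  · simp only [if_true] at hsupp
    have h0 := row 0 1 3 (by omega) (by omega) (by omega) (by omega) fun b hb _ _ => by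
      by_contra hne
      have := hsupp 0 (by omega) b hb hne
      omega
    have h1 := row 1 0 2 (by omega) (by omega) (by omega) (by omega) fun b hb _ _ => by
      by_contra hne
      have := hsupp 1 (by omega) b hb hne
      omega
    have h2 := row 2 1 3 (by omega) (by omega) (by omega) (by omega) fun b hb _ _ => by
      by_contra hne
      have := hsupp 2 (by omega) b hb hne
      omega
    have h10 := hsymm 1 0
    have h21 := hsymm 2 1
    have h30 := hsymm 3 0
    have h32 := hsymm 3 2
    intro a ha b hb
    by_contra hne
    have := hsupp a ha b hb hne
    have : a = 0 ∧ b = 1 ∨ a = 1 ∧ b = 2 ∨ a = 2 ∧ b = 3 ∨ a = 0 ∧ b = 3 ∨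
        a = 1 ∧ b = 0 ∨ a = 2 ∧ b = 1 ∨ a = 3 ∧ b = 2 ∨ a = 3 ∧ b = 0 := by omega
    rcases this with ⟨rfl, rfl⟩ | ⟨rfl, rfl⟩ | ⟨rfl, rfl⟩ | ⟨rfl, rfl⟩ | ⟨rfl, rfl⟩ | ⟨rfl, rfl⟩ |
      ⟨rfl, rfl⟩ | ⟨rfl, rfl⟩ <;> omega
  · simp only [if_neg hn.ne'] at hsupp
    have h02 : Y 0 2 = 0 := by
      have := row 0 1 2 (by omega) (by omega) (by omega) (by omega) fun b hb _ _ => by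
        by_contra hne
        have := hsupp 0 (by omega) b hb hne
        omega
      omega
    have h20 := (hsymm 2 0).trans h02
    have hpath : ∀ k, k + 4 ≤ n → Y k (k + 1) = 0 := by
      intro k
      induction k with
      | zero => exact fun _ => h01
      | succ k ih =>
        intro hk
        have hk0 := ih (by omega)
        rw [hsymm] at hk0
        have := row (k + 1) k (k + 1 + 1) (by omega) (by omega) (by omega) (by omega)
          fun b hb _ _ => by
            by_contra hne
            have := hsupp (k + 1) (by omega) b hb hne
            have hk1 : k + 1 = 2 ∧ b = 0 := by omega
            rw [hk1.1, hk1.2] at hne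
            exact hne h20
        omega
    obtain ⟨m, rfl⟩ : ∃ m, n = m + 4 := ⟨n - 4, by omega⟩
    have hm := hpath m le_rfl
    rw [hsymm] at hm
    have h1 := row (m + 1) (m + 2) (m + 3) (by omega) (by omega) (by omega) (by omega)
      fun b hb _ _ => by
        by_contra hne
        have := hsupp (m + 1) (by omega) b hb hne
        have hb : b = m ∨ m + 1 = 2 ∧ b = 0 := by omega
        rcases hb with rfl | hb
        · exact hne hm
        · rw [hb.1, hb.2] at hne
          exact hne h20
    have h2 := row (m + 2) (m + 1) (m + 3) (by omega) (by omega) (by omega) (by omega)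
      fun b hb _ _ => by
        by_contra hne
        have := hsupp (m + 2) (by omega) b hb hne
        omega
    have h3 := row (m + 3) (m + 1) (m + 2) (by omega) (by omega) (by omega) (by omega)
      fun b hb _ _ => by
        by_contra hne
        have := hsupp (m + 3) (by omega) b hb hne
        omega
    have h21 := hsymm (m + 2) (m + 1)
    have h31 := hsymm (m + 3) (m + 1)
    have h32 := hsymm (m + 3) (m + 2)
    have hlt : ∀ a < m + 4, ∀ b < m + 4, a < b → Y a b = 0 := by
      intro a ha b hb hab
      by_contra hne
      have := hsupp a ha b hb hne
      have : b = a + 1 ∧ a ≤ m ∨ a = 0 ∧ b = 2 ∨ a = m + 1 ∧ b = m + 2 ∨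
          a = m + 1 ∧ b = m + 3 ∨ a = m + 2 ∧ b = m + 3 := by omega
      rcases this with ⟨rfl, ham⟩ | ⟨rfl, rfl⟩ | ⟨rfl, rfl⟩ | ⟨rfl, rfl⟩ | ⟨rfl, rfl⟩
      · exact hne (hpath a (by omega))
      all_goals omega
    intro a ha b hb
    rcases lt_trichotomy a b with hab | rfl | hab
    · exact hlt a ha b hb hab
    · by_contra hne
      have := hsupp a ha a hb hne
      omega
    · rw [hsymm]
      exact hlt b hb a ha hab

end TrianglesWalk

section CompleteGraph

open Finset

theorem stepExp_apply_ne_zero_iff {W : Type*} {G : SimpleGraph W} {ed : ℕ → G.edgeSet}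
    {S : Finset ℕ} {r : ℕ} {e : G.edgeSet} :
    stepExp ed S r e ≠ 0 ↔ ∃ i ∈ S, i % 2 = r ∧ ed i = e := by
  classical
  simp [stepExp, Finsupp.finsetSum_apply, Finsupp.single_apply]

theorem exists_isRigidPair {n : ℕ} (hn : 4 ≤ n) [Fintype (⊤ : SimpleGraph (Fin n)).edgeSet] :
    ∃ u v : (⊤ : SimpleGraph (Fin n)).edgeSet →₀ ℕ, ∃ e₀,
      IsRigidPair u v e₀ ∧ u.degree = n - 2 := by
  classical
  let p : ℕ → Fin n := fun i => ⟨trianglesWalk n i, trianglesWalk_lt hn i⟩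
  have hstep : ∀ i < 2 * n - 4, s(p i, p (i + 1)) ∈ (⊤ : SimpleGraph (Fin n)).edgeSet := by
    intro i hi
    simpa [p] using trianglesWalk_ne_succ hn hi
  let ed : ℕ → (⊤ : SimpleGraph (Fin n)).edgeSet := fun i =>
    if hi : i < 2 * n - 4 then ⟨_, hstep i hi⟩ else ⟨_, hstep 0 (by omega)⟩
  have hed : ∀ i ∈ range (2 * n - 4), (ed i : Sym2 (Fin n)) = s(p i, p (i + 1)) := by
    intro i hi
    simp only [ed, dif_pos (mem_range.1 hi)]
  have hinj : ∀ i ∈ range (2 * n - 4), ∀ j ∈ range (2 * n - 4), ed i = ed j →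
      trianglesWalk n i = trianglesWalk n j ∧
          trianglesWalk n (i + 1) = trianglesWalk n (j + 1) ∨
        trianglesWalk n i = trianglesWalk n (j + 1) ∧
          trianglesWalk n (i + 1) = trianglesWalk n j := by
    intro i hi j hj hij
    have := congrArg Subtype.val hij
    rw [hed i hi, hed j hj] at this
    simpa [p] using this
  have hzero : trianglesWalk n 0 = 0 := if_pos (by omega)
  have hone : trianglesWalk n 1 = 1 := if_pos (by omega)
  have h0 : 0 ∈ range (2 * n - 4) := mem_range.2 (by omega)
  have hclosed : p 0 = p (2 * n - 4) := by
    have := trianglesWalk_cases n (2 * n - 4)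
    ext
    change trianglesWalk n 0 = trianglesWalk n (2 * n - 4)
    omega
  have hbal := (isBalanced_iff hed).1 <| by
    rw [range_eq_Ico]
    exact isBalanced_Ico (Nat.zero_le _) hclosed (by omega)
  refine ⟨_, _, ed 0, ⟨?_, ?_, hbal, ?_⟩, ?_⟩
  · intro e
    by_contra! h
    obtain ⟨i, hi, hi0, rfl⟩ := stepExp_apply_ne_zero_iff.1 h.1
    obtain ⟨j, hj, hj1, hij⟩ := stepExp_apply_ne_zero_iff.1 h.2
    have := trianglesWalk_mod_two_eq hn (mem_range.1 hj) (mem_range.1 hi) (hinj j hj i hi hij)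
    omega
  · rw [stepExp, Finsupp.finsetSum_apply, sum_eq_single_of_mem 0 (by simpa using h0)]
    · simp
    · intro i hi hne
      rw [mem_filter] at hi
      refine Finsupp.single_eq_of_ne' fun h => hne ?_
      refine trianglesWalk_eq_zero_one hn (mem_range.1 hi.1) ?_
      simpa only [hzero, hone, zero_add] using hinj i hi.1 0 h0 h
  · intro y hsum hsupp hy
    let Z : Sym2 (Fin n) → ℤ := fun s =>
      if hs : s ∈ (⊤ : SimpleGraph (Fin n)).edgeSet then y ⟨s, hs⟩ else 0
    have hZ : ∀ e : (⊤ : SimpleGraph (Fin n)).edgeSet, Z e = y e := fun e => dif_pos e.2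
    have hZ' : ∀ s, s ∉ (⊤ : SimpleGraph (Fin n)).edgeSet → Z s = 0 := fun s hs => dif_neg hs
    have hZstep : ∀ a b : Fin n, Z s(a, b) ≠ 0 → ∃ i < 2 * n - 4,
        s(a, b) = s(p i, p (i + 1)) := by
      intro a b hab
      have hmem : s(a, b) ∈ (⊤ : SimpleGraph (Fin n)).edgeSet := by
        by_contra h
        exact hab (hZ' _ h)
      have hne : y ⟨s(a, b), hmem⟩ ≠ 0 := by rwa [← hZ ⟨s(a, b), hmem⟩]
      have hex : ∃ i ∈ range (2 * n - 4), ed i = ⟨s(a, b), hmem⟩ := by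
        rcases hsupp _ hne with h | h <;>
        · obtain ⟨i, hi, -, hie⟩ := stepExp_apply_ne_zero_iff.1 h
          exact ⟨i, hi, hie⟩
      obtain ⟨i, hi, hie⟩ := hex
      exact ⟨i, mem_range.1 hi, by rw [← hed i hi, hie]⟩
    let Y : ℕ → ℕ → ℤ := fun a b =>
      if h : a < n ∧ b < n then Z s(⟨a, h.1⟩, ⟨b, h.2⟩) else 0
    have hY : ∀ a b : Fin n, Y a b = Z s(a, b) := fun a b => dif_pos ⟨a.2, b.2⟩
    have hYzero := eq_zero_of_sum_eq_zero hn Y ?_ ?_ ?_ ?_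
    · funext e
      obtain ⟨⟨a, b⟩, he⟩ := e
      exact (hZ _).symm.trans ((hY a b).symm.trans (hYzero a a.2 b b.2))
    · intro a b
      simp only [Y, and_comm (a := b < n), Sym2.eq_swap]
    · intro a ha
      rw [sum_range]
      exact (sum_congr rfl fun b _ => hY ⟨a, ha⟩ b).trans
        ((sum_neighbors_eq y Z hZ hZ' ⟨a, ha⟩).trans (hsum _))
    · intro a ha b hb hab
      obtain ⟨i, hi, h⟩ := hZstep ⟨a, ha⟩ ⟨b, hb⟩ (hY ⟨a, ha⟩ ⟨b, hb⟩ ▸ hab)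
      refine trianglesWalk_step hn hi ?_
      simpa [p] using h
    · have h01 : (ed 0 : Sym2 (Fin n)) = s(⟨0, by omega⟩, ⟨1, by omega⟩) := by
        rw [hed 0 h0]
        simp [p, hzero, hone]
      rw [← hZ, h01] at hy
      exact (hY ⟨0, by omega⟩ ⟨1, by omega⟩).trans hy
  · have hcard := degree_stepExp_add ed (range (2 * n - 4))
    rw [← degree_eq_of_vertexDegree_eq hbal, card_range] at hcard
    omega

end CompleteGraph

/-- For `n ≥ 4`, the largest total degree of a binomial in the Graver basis
of `I_{K_n}` is exactly `n - 2`, and this maximal degree is attained by a circuit. -/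
theorem maxDegree_Graver_completeGraph (K : Type*) [Field K] (n : ℕ) (hn : 4 ≤ n) :
    IsGreatest {d : ℕ |
        ∃ f, IsPrimitiveBinomial (graphToricIdeal K (⊤ : SimpleGraph (Fin n))) f ∧
          f.totalDegree = d} (n - 2) ∧
    ∃ f, IsCircuitBinomial (graphToricIdeal K (⊤ : SimpleGraph (Fin n))) f ∧
      f.totalDegree = n - 2 := by
  classical
  have := Fintype.ofFinite (⊤ : SimpleGraph (Fin n)).edgeSet
  obtain ⟨u, v, e₀, h, hu⟩ := exists_isRigidPair hn
  have hdeg : (binom K u v).totalDegree = n - 2 :=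
    (totalDegree_binom K h.ne (degree_eq_of_vertexDegree_eq h.vertexDegree_eq)).trans hu
  refine ⟨⟨⟨_, (isPrimitiveBinomial_iff K).2 ⟨u, v, h.isPrimitivePair, rfl⟩, hdeg⟩, ?_⟩,
    _, h.isCircuitBinomial K, hdeg⟩
  rintro _ ⟨f, hf, rfl⟩
  obtain ⟨w, z, hwz, rfl⟩ := (isPrimitiveBinomial_iff K).1 hf
  have hle := hwz.degree_add_two_le (by simpa using hn)
  rw [Fintype.card_fin] at hle
  rw [totalDegree_binom K hwz.ne (degree_eq_of_vertexDegree_eq hwz.vertexDegree_eq)]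
  omega

end
end

section
/- Let w be a primitive even closed walk of a finite simple graph on n vertices, and let s be the number of blocks of the subgraph 𝐰. Then 2·deg(B_w) ≤ n + s − 1, where deg(B_w) is half the length of w. Moreover, 2·deg(B_w) equals the total number of edges of the cyclic blocks of 𝐰 plus twice the number of blocks of 𝐰 that are cut edges. -/
open MvPolynomial

noncomputable section

variable {σ : Type*} {K : Type*} [Field K]

/-! ### Toric ideals of graphs -/

variable {V : Type*}

/-! ### Blocks of a union of two graphs sharing one vertex -/

section Gluing

variable {H₁ H₂ : SimpleGraph V} {x : V}

lemma not_le_of_support_inter (hx : H₁.support ∩ H₂.support ⊆ {x}) {B : SimpleGraph V}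
    (hB : B.edgeSet.Nonempty) (h₁ : B ≤ H₁) (h₂ : B ≤ H₂) : False := by
  obtain ⟨e, he⟩ := hB
  induction e using Sym2.ind with
  | _ a b =>
    rw [SimpleGraph.mem_edgeSet] at he
    have ha : a = x := hx ⟨⟨b, h₁ he⟩, ⟨b, h₂ he⟩⟩
    have hb : b = x := hx ⟨⟨a, h₁ he.symm⟩, ⟨a, h₂ he.symm⟩⟩
    exact he.ne (ha.trans hb.symm)

lemma IsBiconnected.le_or_le_of_le_sup (hx : H₁.support ∩ H₂.support ⊆ {x})
    {B : SimpleGraph V} (hB : IsBiconnected B) (hle : B ≤ H₁ ⊔ H₂) : B ≤ H₁ ∨ B ≤ H₂ := by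
  by_contra! hcon
  obtain ⟨h₁, h₂⟩ := hcon
  have exists_ne : ∀ {a b : V} {H : SimpleGraph V}, B.Adj a b → H.Adj a b →
      ∃ c, c ≠ x ∧ c ∈ B.support ∧ c ∈ H.support := by
    intro a b H hb hh
    by_cases ha : a = x
    · exact ⟨b, fun h => hb.ne (ha.trans h.symm), ⟨a, hb.symm⟩, ⟨a, hh.symm⟩⟩
    · exact ⟨a, ha, ⟨b, hb⟩, ⟨b, hh⟩⟩
  obtain ⟨a, hax, haB, ha⟩ : ∃ c, c ≠ x ∧ c ∈ B.support ∧ c ∈ H₂.support := by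
    rw [SimpleGraph.le_iff_adj] at h₁
    push Not at h₁
    obtain ⟨a, b, hab, hn⟩ := h₁
    exact exists_ne hab ((hle hab).resolve_left hn)
  obtain ⟨b, hbx, hbB, hb⟩ : ∃ c, c ≠ x ∧ c ∈ B.support ∧ c ∈ H₁.support := by
    rw [SimpleGraph.le_iff_adj] at h₂
    push Not at h₂
    obtain ⟨a, b, hab, hn⟩ := h₂
    exact exists_ne hab ((hle hab).resolve_right hn)
  apply hB.2.2 x
  refine ⟨a, b, hax, hbx, hB.2.1 a haB b hbB, ?_⟩
  rintro ⟨p⟩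
  have key : ∀ {c d : V} (p : (SimpleGraph.fromEdgeSet
      {e | e ∈ B.edgeSet ∧ x ∉ e}).Walk c d), c ≠ x → c ∈ H₂.support →
      d ≠ x ∧ d ∈ H₂.support := by
    intro c d p
    induction p with
    | nil => exact fun h h' => ⟨h, h'⟩
    | @cons u v w huv p ih =>
      intro hux hu
      rw [SimpleGraph.fromEdgeSet_adj] at huv
      obtain ⟨⟨hB', hx'⟩, -⟩ := huv
      rw [SimpleGraph.mem_edgeSet] at hB'
      apply ih
      · rintro rfl
        exact hx' (Sym2.mem_mk_right _ _)
      · rcases hle hB' with h | h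
        · exact absurd (hx ⟨⟨v, h⟩, hu⟩) hux
        · exact ⟨u, h.symm⟩
  exact hbx (hx ⟨hb, (key p hax ha).2⟩)

lemma IsBlock.sup_left (hx : H₁.support ∩ H₂.support ⊆ {x}) {B : SimpleGraph V}
    (hB : IsBlock H₁ B) : IsBlock (H₁ ⊔ H₂) B := by
  refine ⟨hB.1.trans le_sup_left, hB.2.1, fun B' hBB' hB' hbi => ?_⟩
  rcases hbi.le_or_le_of_le_sup hx hB' with h | h
  · exact hB.2.2 B' hBB' h hbi
  · exact (not_le_of_support_inter hx hB.2.1.1 hB.1 (hBB'.trans h)).elim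

lemma isBlock_sup_iff (hx : H₁.support ∩ H₂.support ⊆ {x}) {B : SimpleGraph V} :
    IsBlock (H₁ ⊔ H₂) B ↔ IsBlock H₁ B ∨ IsBlock H₂ B := by
  constructor
  · intro hB
    rcases hB.2.1.le_or_le_of_le_sup hx hB.1 with h | h
    · exact .inl ⟨h, hB.2.1, fun B' h₁ h₂ => hB.2.2 B' h₁ (h₂.trans le_sup_left)⟩
    · exact .inr ⟨h, hB.2.1, fun B' h₁ h₂ => hB.2.2 B' h₁ (h₂.trans le_sup_right)⟩
  · rintro (h | h)
    · exact h.sup_left hx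
    · rw [sup_comm]
      exact h.sup_left (Set.inter_comm _ _ ▸ hx)

lemma IsCutEdge.sup_left (hx : H₁.support ∩ H₂.support ⊆ {x}) {e : Sym2 V}
    (he : IsCutEdge H₁ e) : IsCutEdge (H₁ ⊔ H₂) e := by
  classical
  obtain ⟨he, a, b, hab, hn⟩ := he
  refine ⟨SimpleGraph.edgeSet_mono le_sup_left he, a, b, hab.mono le_sup_left, ?_⟩
  have hne : a ≠ b := by rintro rfl; exact hn .rfl
  have hsupp : ∀ {a b : V}, a ≠ b → H₁.Reachable a b → a ∈ H₁.support := by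
    rintro a b hne ⟨p⟩
    cases p with
    | nil => exact (hne rfl).elim
    | cons h _ => exact ⟨_, h⟩
  rintro ⟨p⟩
  have key : ∀ {c d : V} (p : ((H₁ ⊔ H₂).deleteEdges {e}).Walk c d),
      (H₁.deleteEdges {e}).Reachable (if c ∈ H₁.support then c else x)
        (if d ∈ H₁.support then d else x) := by
    intro c d p
    induction p with
    | nil => exact .rfl
    | @cons u v w huv p ih =>
      refine .trans ?_ ih
      rw [SimpleGraph.deleteEdges_adj] at huv
      obtain ⟨h | h, hne⟩ := huv
      · rw [if_pos ⟨v, h⟩, if_pos ⟨u, h.symm⟩]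
        exact (SimpleGraph.deleteEdges_adj.mpr ⟨h, hne⟩).reachable
      · have aux : ∀ u ∈ H₂.support, (if u ∈ H₁.support then u else x) = x := by
          intro u hu
          split_ifs with hu'
          · exact hx ⟨hu', hu⟩
          · rfl
        rw [aux u ⟨v, h⟩, aux v ⟨u, h.symm⟩]
  have := key p
  rw [if_pos (hsupp hne hab), if_pos (hsupp hne.symm hab.symm)] at this
  exact hn this

end Gluing

/-! ### Counting blocks in cactus graphs -/

/-- The set of edges lying on cyclic blocks of `H`. -/
def cyclicBlockEdges (H : SimpleGraph V) : Set (Sym2 V) :=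
  {e | ∃ B : SimpleGraph V, IsBlock H B ∧ IsCycleGraph B ∧ e ∈ B.edgeSet}

/-- The blocks of `H` consisting of a single edge. -/
def edgeBlocks (H : SimpleGraph V) : Set (SimpleGraph V) :=
  {B | IsBlock H B ∧ ∃ e, B.edgeSet = {e}}

/-- Every one-edge block of `H` is a cut edge, and `N` is both the number of vertices plus the
number of blocks minus one, and the number of edges on cyclic blocks plus twice the number of
one-edge blocks. -/
structure IsCactusOfLength (H : SimpleGraph V) (N : ℕ) : Prop where
  support_add_blocks : H.support.ncard + {B | IsBlock H B}.ncard = N + 1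
  length_eq : N = (cyclicBlockEdges H).ncard + 2 * (edgeBlocks H).ncard
  isCutEdge : ∀ B e, IsBlock H B → B.edgeSet = {e} → IsCutEdge H e

lemma SimpleGraph.support_sup (H₁ H₂ : SimpleGraph V) :
    (H₁ ⊔ H₂).support = H₁.support ∪ H₂.support := by
  ext v
  simp [SimpleGraph.mem_support, exists_or]

lemma IsCactusOfLength.sup [Finite V] {H₁ H₂ : SimpleGraph V} {x : V} {N₁ N₂ : ℕ}
    (h₁ : IsCactusOfLength H₁ N₁) (h₂ : IsCactusOfLength H₂ N₂)
    (hx : H₁.support ∩ H₂.support = {x}) : IsCactusOfLength (H₁ ⊔ H₂) (N₁ + N₂) := by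
  have hx' := hx.subset
  have hblocks : {B | IsBlock (H₁ ⊔ H₂) B} = {B | IsBlock H₁ B} ∪ {B | IsBlock H₂ B} := by
    ext B
    exact isBlock_sup_iff hx'
  have hdisj : Disjoint {B | IsBlock H₁ B} {B | IsBlock H₂ B} := by
    rw [Set.disjoint_left]
    exact fun B hB hB' => not_le_of_support_inter hx' hB.2.1.1 hB.1 hB'.1
  have hedges : edgeBlocks (H₁ ⊔ H₂) = edgeBlocks H₁ ∪ edgeBlocks H₂ := by
    ext B
    simp only [edgeBlocks, isBlock_sup_iff hx', Set.mem_ofPred_eq, Set.mem_union]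
    tauto
  have hcyc : cyclicBlockEdges (H₁ ⊔ H₂) = cyclicBlockEdges H₁ ∪ cyclicBlockEdges H₂ := by
    ext e
    simp only [cyclicBlockEdges, isBlock_sup_iff hx', Set.mem_ofPred_eq, Set.mem_union,
      or_and_right, exists_or]
  have hcycdisj : Disjoint (cyclicBlockEdges H₁) (cyclicBlockEdges H₂) := by
    rw [Set.disjoint_left]
    rintro e ⟨B, hB, -, he⟩ ⟨B', hB', -, he'⟩
    refine not_le_of_support_inter (B := H₁ ⊓ H₂) hx' ⟨e, ?_⟩ inf_le_left inf_le_right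
    rw [SimpleGraph.edgeSet_inf]
    exact ⟨SimpleGraph.edgeSet_mono hB.1 he, SimpleGraph.edgeSet_mono hB'.1 he'⟩
  refine ⟨?_, ?_, ?_⟩
  · have hs := Set.ncard_union_add_ncard_inter H₁.support H₂.support
    rw [hx, Set.ncard_singleton] at hs
    rw [SimpleGraph.support_sup, hblocks, Set.ncard_union_eq hdisj]
    have := h₁.support_add_blocks
    have := h₂.support_add_blocks
    omega
  · rw [hcyc, hedges, Set.ncard_union_eq hcycdisj, Set.ncard_union_eq
      (hdisj.mono (fun _ h => h.1) fun _ h => h.1)]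
    have := h₁.length_eq
    have := h₂.length_eq
    omega
  · intro B e hB he
    rcases (isBlock_sup_iff hx').mp hB with h | h
    · exact (h₁.isCutEdge B e h he).sup_left hx'
    · rw [sup_comm]
      exact (h₂.isCutEdge B e h he).sup_left (Set.inter_comm _ _ ▸ hx')

lemma IsBiconnected.isBlock_iff {H : SimpleGraph V} (hH : IsBiconnected H) {B : SimpleGraph V} :
    IsBlock H B ↔ B = H := by
  constructor
  · exact fun hB => (hB.2.2 H hB.1 le_rfl hH).symm
  · rintro rfl
    exact ⟨le_rfl, hH, fun B' h h' _ => le_antisymm h' h⟩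

lemma IsCycleGraph.edgeSet_ne_singleton {B : SimpleGraph V} (hB : IsCycleGraph B) (e : Sym2 V) :
    B.edgeSet ≠ {e} := by
  obtain ⟨n, f, hn, hinj, hB⟩ := hB
  rw [hB]
  intro h
  have h₀ : s(f 0, f ((0 + 1) % n)) ∈ ({e} : Set (Sym2 V)) := h ▸ ⟨0, by omega, rfl⟩
  have h₁ : s(f 1, f ((1 + 1) % n)) ∈ ({e} : Set (Sym2 V)) := h ▸ ⟨1, by omega, rfl⟩
  rw [Set.mem_singleton_iff] at h₀ h₁
  rw [← h₁, Nat.mod_eq_of_lt (by omega), Nat.mod_eq_of_lt (by omega), Sym2.eq_iff] at h₀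
  rcases h₀ with h | h
  · exact absurd (hinj _ _ (by omega) (by omega) h.1) (by omega)
  · exact absurd (hinj _ _ (by omega) (by omega) h.1) (by omega)

/-! ### Graphs of closed sequences of vertices -/

/-- The graph spanned by the first `N` edges of a sequence of vertices. -/
def seqGraph (N : ℕ) (v : ℕ → V) : SimpleGraph V :=
  SimpleGraph.fromEdgeSet {e | ∃ i, ∃ _ : i < N, e = s(v i, v (i + 1))}

section SeqGraph

variable {N : ℕ} {v : ℕ → V}

lemma seqGraph_adj {a b : V} : (seqGraph N v).Adj a b ↔
    (∃ i < N, s(a, b) = s(v i, v (i + 1))) ∧ a ≠ b := by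
  simp [seqGraph]

lemma edgeSet_seqGraph (hne : ∀ i < N, v i ≠ v (i + 1)) :
    (seqGraph N v).edgeSet = {e | ∃ i, ∃ _ : i < N, e = s(v i, v (i + 1))} := by
  ext e
  simp only [seqGraph, SimpleGraph.edgeSet_fromEdgeSet, Set.mem_sdiff, Set.mem_ofPred_eq]
  refine ⟨fun h => h.1, fun h => ⟨h, ?_⟩⟩
  obtain ⟨i, hi, rfl⟩ := h
  simpa using hne i hi

lemma support_seqGraph (hne : ∀ i < N, v i ≠ v (i + 1)) (hcl : v N = v 0) :
    (seqGraph N v).support = v '' Set.Iio N := by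
  ext a
  constructor
  · rintro ⟨b, hb⟩
    obtain ⟨⟨i, hi, h⟩, -⟩ := seqGraph_adj.mp hb
    rcases Sym2.eq_iff.mp h with h | h
    · exact ⟨i, hi, h.1.symm⟩
    · rcases Nat.lt_or_ge (i + 1) N with h' | h'
      · exact ⟨i + 1, h', h.1.symm⟩
      · refine ⟨0, Set.mem_Iio.mpr (by omega), ?_⟩
        rw [← hcl, h.1, show N = i + 1 by omega]
  · rintro ⟨i, hi, rfl⟩
    exact ⟨v (i + 1), seqGraph_adj.mpr ⟨⟨i, hi, rfl⟩, hne i hi⟩⟩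

lemma reachable_of_chain {F : SimpleGraph V} {i j : ℕ} (hij : i ≤ j)
    (h : ∀ t, i ≤ t → t < j → F.Adj (v t) (v (t + 1))) : F.Reachable (v i) (v j) := by
  induction j, hij using Nat.le_induction with
  | base => exact .rfl
  | succ j hij ih =>
    exact (ih fun t h₁ h₂ => h t h₁ (by omega)).trans (h j hij (by omega)).reachable

lemma isBiconnected_seqGraph (hN : 0 < N) (hne : ∀ i < N, v i ≠ v (i + 1)) (hcl : v N = v 0)
    (hinj : Set.InjOn v (Set.Iio N)) : IsBiconnected (seqGraph N v) := by
  have hadj : ∀ i < N, (seqGraph N v).Adj (v i) (v (i + 1)) := fun i hi =>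
    seqGraph_adj.mpr ⟨⟨i, hi, rfl⟩, hne i hi⟩
  refine ⟨⟨s(v 0, v 1), hadj 0 hN⟩, ?_, ?_⟩
  · rw [support_seqGraph hne hcl]
    have h0 : ∀ i < N, (seqGraph N v).Reachable (v 0) (v i) := fun i hi =>
      reachable_of_chain (Nat.zero_le _) fun t _ ht => hadj t (by omega)
    rintro _ ⟨i, hi, rfl⟩ _ ⟨j, hj, rfl⟩
    exact (h0 i hi).symm.trans (h0 j hj)
  · rintro x ⟨a, b, hax, hbx, hab, hn⟩
    have hne' : a ≠ b := by rintro rfl; exact hn .rfl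
    have hsupp : ∀ {a b : V}, a ≠ b → (seqGraph N v).Reachable a b →
        a ∈ v '' Set.Iio N := by
      rintro a b hne' ⟨p⟩
      cases p with
      | nil => exact (hne' rfl).elim
      | cons h _ => exact support_seqGraph hne hcl ▸ ⟨_, h⟩
    set F := SimpleGraph.fromEdgeSet {e | e ∈ (seqGraph N v).edgeSet ∧ x ∉ e} with hF
    have hFadj : ∀ t < N, v t ≠ x → v (t + 1) ≠ x → F.Adj (v t) (v (t + 1)) := by
      intro t ht h₁ h₂
      rw [hF, SimpleGraph.fromEdgeSet_adj]
      refine ⟨⟨hadj t ht, ?_⟩, hne t ht⟩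
      rw [Sym2.mem_iff]
      rintro (h | h)
      exacts [h₁ h.symm, h₂ h.symm]
    have key : ∀ i j, i < j → j < N → v i ≠ x → v j ≠ x → F.Reachable (v i) (v j) := by
      intro i j hij hj hi hjx
      by_cases hk : ∃ k, i < k ∧ k < j ∧ v k = x
      · obtain ⟨k, hik, hkj, rfl⟩ := hk
        have hk' : ∀ t < N, t ≠ k → v t ≠ v k := fun t ht htk h =>
          htk (hinj ht (hkj.trans hj) h)
        have hk'' : ∀ t ≤ N, t ≠ k → v t ≠ v k := by
          intro t ht htk
          rcases ht.lt_or_eq with h | rfl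
          · exact hk' t h htk
          · rw [hcl]
            exact hk' 0 (by omega) (by omega)
        have h₁ : F.Reachable (v 0) (v i) := reachable_of_chain (Nat.zero_le _)
          fun t _ ht => hFadj t (by omega) (hk' _ (by omega) (by omega))
            (hk' _ (by omega) (by omega))
        have h₂ : F.Reachable (v j) (v N) := reachable_of_chain hj.le
          fun t _ ht => hFadj t (by omega) (hk' _ (by omega) (by omega))
            (hk'' _ (by omega) (by omega))
        rw [hcl] at h₂
        exact (h₂.trans h₁).symm
      · push Not at hk
        have hk' : ∀ t, i ≤ t → t ≤ j → v t ≠ x := by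
          intro t h₁ h₂
          rcases h₁.eq_or_lt with rfl | h₁
          · exact hi
          rcases h₂.eq_or_lt with rfl | h₂
          · exact hjx
          exact hk t h₁ h₂
        exact reachable_of_chain hij.le fun t h₁ h₂ =>
          hFadj t (by omega) (hk' _ h₁ h₂.le) (hk' _ (by omega) (by omega))
    obtain ⟨i, hi, rfl⟩ := hsupp hne' hab
    obtain ⟨j, hj, rfl⟩ := hsupp hne'.symm hab.symm
    rcases lt_trichotomy i j with h | rfl | h
    · exact hn (key i j h hj hax hbx)
    · exact hne' rfl
    · exact hn (key j i h hi hbx hax).symm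

lemma ncard_support_seqGraph (hne : ∀ i < N, v i ≠ v (i + 1)) (hcl : v N = v 0)
    (hinj : Set.InjOn v (Set.Iio N)) : (seqGraph N v).support.ncard = N := by
  rw [support_seqGraph hne hcl, hinj.ncard_image, ← Finset.coe_Iio,
    Set.ncard_coe_finset, Nat.card_Iio]

lemma isCactusOfLength_two {v : ℕ → V} (hne : ∀ i < 2, v i ≠ v (i + 1)) (hcl : v 2 = v 0)
    (hinj : Set.InjOn v (Set.Iio 2)) : IsCactusOfLength (seqGraph 2 v) 2 := by
  have hbi := isBiconnected_seqGraph two_pos hne hcl hinj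
  have hedge : (seqGraph 2 v).edgeSet = {s(v 0, v 1)} := by
    rw [edgeSet_seqGraph hne]
    ext e
    constructor
    · rintro ⟨i, hi, rfl⟩
      interval_cases i
      · rfl
      · simp [hcl, Sym2.eq_swap]
    · rintro rfl
      exact ⟨0, two_pos, rfl⟩
  have hcyc : cyclicBlockEdges (seqGraph 2 v) = ∅ := by
    refine Set.eq_empty_of_forall_notMem ?_
    rintro e ⟨B, hB, hc, -⟩
    rw [hbi.isBlock_iff] at hB
    subst hB
    exact hc.edgeSet_ne_singleton _ hedge
  have heb : edgeBlocks (seqGraph 2 v) = {seqGraph 2 v} := by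
    ext B
    simp only [edgeBlocks, hbi.isBlock_iff, Set.mem_ofPred_eq, Set.mem_singleton_iff]
    exact ⟨fun h => h.1, fun h => ⟨h, _, h ▸ hedge⟩⟩
  refine ⟨?_, ?_, ?_⟩
  · simp [ncard_support_seqGraph hne hcl hinj, hbi.isBlock_iff]
  · simp [hcyc, heb]
  · intro B e hB he
    rw [hbi.isBlock_iff] at hB
    subst hB
    have hadj : (seqGraph 2 v).Adj (v 0) (v 1) :=
      seqGraph_adj.mpr ⟨⟨0, two_pos, rfl⟩, hne 0 two_pos⟩
    refine ⟨he ▸ rfl, v 0, v 1, hadj.reachable, ?_⟩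
    have : (seqGraph 2 v).deleteEdges {e} = ⊥ := by
      rw [← SimpleGraph.edgeSet_eq_empty, SimpleGraph.edgeSet_deleteEdges, he, Set.sdiff_self]
    rw [this, SimpleGraph.reachable_bot]
    exact hadj.ne

lemma isCactusOfLength_of_three_le (hN : 3 ≤ N) (hne : ∀ i < N, v i ≠ v (i + 1))
    (hcl : v N = v 0) (hinj : Set.InjOn v (Set.Iio N)) :
    IsCactusOfLength (seqGraph N v) N := by
  have hbi := isBiconnected_seqGraph (by omega) hne hcl hinj
  have hmod : ∀ i < N, v ((i + 1) % N) = v (i + 1) := by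
    intro i hi
    rcases Nat.lt_or_ge (i + 1) N with h | h
    · rw [Nat.mod_eq_of_lt h]
    · rw [show i + 1 = N by omega, Nat.mod_self, hcl]
  have hedge : (seqGraph N v).edgeSet = (fun i => s(v i, v (i + 1))) '' Set.Iio N := by
    rw [edgeSet_seqGraph hne]
    ext e
    simp [eq_comm]
  have hcg : IsCycleGraph (seqGraph N v) := by
    refine ⟨N, v, hN, fun i j hi hj h => hinj hi hj h, ?_⟩
    rw [edgeSet_seqGraph hne]
    ext e
    refine exists_congr fun i => exists_congr fun hi => ?_
    rw [hmod i hi]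
  have hedgeinj : Set.InjOn (fun i => s(v i, v (i + 1))) (Set.Iio N) := by
    intro i hi j hj h
    rcases Sym2.eq_iff.mp h with h | h
    · exact hinj hi hj h.1
    · rw [← hmod i hi, ← hmod j hj] at h
      have h₁ := hinj hi (Set.mem_Iio.mpr (Nat.mod_lt _ (by omega))) h.1
      have h₂ := hinj (Set.mem_Iio.mpr (Nat.mod_lt _ (by omega))) hj h.2
      rw [Set.mem_Iio] at hi hj
      rcases Nat.lt_or_ge (i + 1) N with h' | h' <;>
      rcases Nat.lt_or_ge (j + 1) N with h'' | h''
      · rw [Nat.mod_eq_of_lt h''] at h₁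
        rw [Nat.mod_eq_of_lt h'] at h₂
        omega
      · rw [show j + 1 = N by omega, Nat.mod_self] at h₁
        rw [Nat.mod_eq_of_lt h'] at h₂
        omega
      · rw [Nat.mod_eq_of_lt h''] at h₁
        rw [show i + 1 = N by omega, Nat.mod_self] at h₂
        omega
      · omega
  have hcyc : cyclicBlockEdges (seqGraph N v) = (seqGraph N v).edgeSet := by
    ext e
    simp only [cyclicBlockEdges, hbi.isBlock_iff, Set.mem_ofPred_eq, exists_eq_left, hcg, true_and]
  have heb : edgeBlocks (seqGraph N v) = ∅ := by
    refine Set.eq_empty_of_forall_notMem ?_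
    rintro B ⟨hB, e, he⟩
    rw [hbi.isBlock_iff] at hB
    subst hB
    exact hcg.edgeSet_ne_singleton e he
  refine ⟨?_, ?_, ?_⟩
  · simp [ncard_support_seqGraph hne hcl hinj, hbi.isBlock_iff]
  · rw [hcyc, heb, hedge, hedgeinj.ncard_image, ← Finset.coe_Iio,
      Set.ncard_coe_finset, Nat.card_Iio]
    simp
  · intro B e hB he
    rw [hbi.isBlock_iff] at hB
    subst hB
    exact (hcg.edgeSet_ne_singleton e he).elim

/-- Whenever a sequence returns to a vertex at times `i < j`, its parts inside and outside
`[i, j)` share only that vertex, and visit it only at these times. -/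
def IsNoncrossing (N : ℕ) (v : ℕ → V) : Prop :=
  ∀ i j, i < j → j < N → v i = v j → ∀ k l, i ≤ k → k < j → l < N → (l < i ∨ j ≤ l) →
    v k = v l → k = i ∧ l = j

lemma IsNoncrossing.comp (h : IsNoncrossing N v) {M : ℕ} {φ : ℕ → ℕ} (hφ : StrictMono φ)
    (hM : ∀ t < M, φ t < N) : IsNoncrossing M (v ∘ φ) := by
  intro i j hij hj hv k l hik hkj hl hlij hkl
  obtain ⟨h₁, h₂⟩ := h (φ i) (φ j) (hφ hij) (hM j hj) hv (φ k) (φ l) (hφ.monotone hik) (hφ hkj)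
    (hM l hl) (hlij.imp (fun h => hφ h) fun h => hφ.monotone h) hkl
  exact ⟨hφ.injective h₁, hφ.injective h₂⟩

theorem IsNoncrossing.isCactusOfLength [Finite V] {N : ℕ} {v : ℕ → V} (h : IsNoncrossing N v)
    (hN : 0 < N) (hne : ∀ i < N, v i ≠ v (i + 1)) (hcl : v N = v 0) :
    IsCactusOfLength (seqGraph N v) N := by
  induction N using Nat.strong_induction_on generalizing v with
  | _ N ih =>
  by_cases hinj : Set.InjOn v (Set.Iio N)
  · rcases Nat.lt_or_ge N 3 with h3 | h3
    · obtain rfl | rfl : N = 1 ∨ N = 2 := by omega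
      · exact (hne 0 hN hcl.symm).elim
      · exact isCactusOfLength_two hne hcl hinj
    · exact isCactusOfLength_of_three_le h3 hne hcl hinj
  · obtain ⟨i, j, hij, hj, hv⟩ : ∃ i j, i < j ∧ j < N ∧ v i = v j := by
      simp only [Set.InjOn, Set.mem_Iio] at hinj
      push Not at hinj
      obtain ⟨i, hi, j, hj, hv, hij⟩ := hinj
      rcases Nat.lt_or_gt_of_ne hij with h' | h'
      · exact ⟨i, j, h', hj, hv⟩
      · exact ⟨j, i, h', hi, hv.symm⟩
    set φ : ℕ → ℕ := fun t => if t < i then t else t + (j - i) with hφdef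
    set ψ : ℕ → ℕ := fun t => i + t with hψdef
    have hφlt : ∀ t, t < i → φ t = t := fun t ht => if_pos ht
    have hφge : ∀ t, i ≤ t → φ t = t + (j - i) := fun t ht => if_neg (by omega)
    have hφ : StrictMono φ := by
      intro a b hab
      simp only [hφdef]
      split_ifs <;> omega
    have hψ : StrictMono ψ := fun a b hab => Nat.add_lt_add_left hab i
    have hφN : ∀ t < N - (j - i), φ t < N := by
      intro t ht
      simp only [hφdef]
      split_ifs <;> omega
    have hψN : ∀ t < j - i, ψ t < N := by
      intro t ht
      simp only [hψdef]
      omega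
    have hφs : ∀ t, v (φ (t + 1)) = v (φ t + 1) := by
      intro t
      rcases lt_trichotomy (t + 1) i with h' | h' | h'
      · rw [hφlt _ h', hφlt t (by omega)]
      · rw [hφge _ h'.ge, hφlt t (by omega), h', hv]
        congr 1
        omega
      · rw [hφge _ h'.le, hφge t (by omega)]
        congr 1
        omega
    have hφ0 : v (φ 0) = v 0 := by
      rcases Nat.eq_zero_or_pos i with rfl | hi
      · rw [hφge 0 le_rfl, hv]
        simp
      · rw [hφlt 0 hi]
    have hcl₁ : (v ∘ φ) (N - (j - i)) = (v ∘ φ) 0 := by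
      simp only [Function.comp_apply]
      rw [hφ0, hφge _ (by omega), ← hcl]
      congr 1
      omega
    have hcl₂ : (v ∘ ψ) (j - i) = (v ∘ ψ) 0 := by
      simp only [Function.comp_apply, hψdef]
      rw [Nat.add_sub_cancel' hij.le, Nat.add_zero, hv]
    have hne₁ : ∀ t < N - (j - i), (v ∘ φ) t ≠ (v ∘ φ) (t + 1) := by
      intro t ht
      simp only [Function.comp_apply, hφs]
      exact hne _ (hφN t ht)
    have hne₂ : ∀ t < j - i, (v ∘ ψ) t ≠ (v ∘ ψ) (t + 1) := fun t ht => hne _ (hψN t ht)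
    have h₁ := ih (N - (j - i)) (by omega) (h.comp hφ hφN) (by omega) hne₁ hcl₁
    have h₂ := ih (j - i) (by omega) (h.comp hψ hψN) (by omega) hne₂ hcl₂
    have hsup : seqGraph (N - (j - i)) (v ∘ φ) ⊔ seqGraph (j - i) (v ∘ ψ) = seqGraph N v := by
      ext a b
      simp only [SimpleGraph.sup_adj, seqGraph_adj, ← or_and_right, Function.comp_apply, hφs]
      refine and_congr_left fun _ => ⟨?_, ?_⟩
      · rintro (⟨t, ht, h'⟩ | ⟨t, ht, h'⟩)
        · exact ⟨φ t, hφN t ht, h'⟩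
        · exact ⟨ψ t, hψN t ht, h'⟩
      · rintro ⟨t, ht, h'⟩
        rcases Nat.lt_or_ge t i with hti | hti
        · exact .inl ⟨t, by omega, by rw [hφlt t hti, h']⟩
        rcases Nat.lt_or_ge t j with htj | htj
        · refine .inr ⟨t - i, by omega, ?_⟩
          rw [h', show ψ (t - i + 1) = t + 1 by simp only [hψdef]; omega,
            show ψ (t - i) = t by simp only [hψdef]; omega]
        · refine .inl ⟨t - (j - i), by omega, ?_⟩
          rw [h', hφge _ (by omega), Nat.sub_add_cancel (by omega)]
    have hx : (seqGraph (N - (j - i)) (v ∘ φ)).support ∩ (seqGraph (j - i) (v ∘ ψ)).support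
        = {v i} := by
      rw [support_seqGraph hne₁ hcl₁, support_seqGraph hne₂ hcl₂]
      ext a
      constructor
      · rintro ⟨⟨s, hs, rfl⟩, ⟨t, ht, hst⟩⟩
        rw [Set.mem_Iio] at hs ht
        have hout : φ s < i ∨ j ≤ φ s := by
          simp only [hφdef]
          split_ifs <;> omega
        obtain ⟨h', -⟩ := h i j hij hj hv (ψ t) (φ s) (by simp only [hψdef]; omega)
          (by simp only [hψdef]; omega) (hφN s hs) hout hst
        rw [Set.mem_singleton_iff, ← hst, Function.comp_apply, h']
      · rintro rfl
        refine ⟨⟨i, Set.mem_Iio.mpr (by omega), ?_⟩, ⟨0, Set.mem_Iio.mpr (by omega), rfl⟩⟩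
        rw [Function.comp_apply, hφge i le_rfl, Nat.add_sub_cancel' hij.le, hv]
    have := h₁.sup h₂ hx
    rwa [hsup, Nat.sub_add_cancel (by omega)] at this

end SeqGraph

/-! ### Primitive walks are noncrossing -/

namespace EvenClosedWalk

variable {G : SimpleGraph V}

open Classical in
lemma plusExp_apply (w : EvenClosedWalk G) (e : G.edgeSet) : w.plusExp e =
    {k ∈ Finset.range w.q | (e : Sym2 V) = s(w.verts (2 * k), w.verts (2 * k + 1))}.card := by
  rw [plusExp, Finsupp.finsetSum_apply, Finset.card_filter, ← Fin.sum_univ_eq_sum_range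
    (fun k => if (e : Sym2 V) = s(w.verts (2 * k), w.verts (2 * k + 1)) then 1 else 0)]
  refine Finset.sum_congr rfl fun k _ => ?_
  rw [Finsupp.single_apply]
  exact if_congr (by rw [Subtype.ext_iff, eq_comm]; rfl) rfl rfl

open Classical in
lemma minusExp_apply (w : EvenClosedWalk G) (e : G.edgeSet) : w.minusExp e =
    {k ∈ Finset.range w.q | (e : Sym2 V) = s(w.verts (2 * k + 1), w.verts (2 * k + 2))}.card := by
  rw [minusExp, Finsupp.finsetSum_apply, Finset.card_filter, ← Fin.sum_univ_eq_sum_range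
    (fun k => if (e : Sym2 V) = s(w.verts (2 * k + 1), w.verts (2 * k + 2)) then 1 else 0)]
  refine Finset.sum_congr rfl fun k _ => ?_
  rw [Finsupp.single_apply]
  exact if_congr (by rw [Subtype.ext_iff, eq_comm]; rfl) rfl rfl

/-- An injection of positions preserving parity and edges yields divisibility of the monomials
of the walks. -/
lemma exp_le_exp (ξ w : EvenClosedWalk G) (f : ℕ → ℕ) (hf : ∀ t < 2 * ξ.q, f t < 2 * w.q)
    (hinj : Set.InjOn f (Set.Iio (2 * ξ.q))) (hpar : ∀ t < 2 * ξ.q, f t % 2 = t % 2)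
    (hedge : ∀ t < 2 * ξ.q,
      s(ξ.verts t, ξ.verts (t + 1)) = s(w.verts (f t), w.verts (f t + 1))) :
    ξ.plusExp ≤ w.plusExp ∧ ξ.minusExp ≤ w.minusExp := by
  classical
  constructor <;> intro e
  · rw [plusExp_apply, plusExp_apply]
    refine Finset.card_le_card_of_injOn (fun k => f (2 * k) / 2) ?_ ?_
    · intro k hk
      simp only [Finset.coe_filter, Finset.mem_range, Set.mem_ofPred_eq] at hk ⊢
      have h₁ := hf (2 * k) (by omega)
      have h₂ := hpar (2 * k) (by omega)
      refine ⟨by omega, ?_⟩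
      rw [hk.2, hedge _ (by omega), show 2 * (f (2 * k) / 2) = f (2 * k) by omega]
    · intro k hk l hl hkl
      simp only [Finset.coe_filter, Finset.mem_range, Set.mem_ofPred_eq] at hk hl hkl
      have h₁ := hpar (2 * k) (by omega)
      have h₂ := hpar (2 * l) (by omega)
      have := hinj (Set.mem_Iio.mpr (by omega)) (Set.mem_Iio.mpr (by omega))
        (show f (2 * k) = f (2 * l) by omega)
      omega
  · rw [minusExp_apply, minusExp_apply]
    refine Finset.card_le_card_of_injOn (fun k => f (2 * k + 1) / 2) ?_ ?_
    · intro k hk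
      simp only [Finset.coe_filter, Finset.mem_range, Set.mem_ofPred_eq] at hk ⊢
      have h₁ := hf (2 * k + 1) (by omega)
      have h₂ := hpar (2 * k + 1) (by omega)
      refine ⟨by omega, ?_⟩
      rw [hk.2, hedge _ (by omega),
        show 2 * (f (2 * k + 1) / 2) + 1 = f (2 * k + 1) by omega,
        show 2 * (f (2 * k + 1) / 2) + 2 = f (2 * k + 1) + 1 by omega]
    · intro k hk l hl hkl
      simp only [Finset.coe_filter, Finset.mem_range, Set.mem_ofPred_eq] at hk hl hkl
      have h₁ := hpar (2 * k + 1) (by omega)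
      have h₂ := hpar (2 * l + 1) (by omega)
      have := hinj (Set.mem_Iio.mpr (by omega)) (Set.mem_Iio.mpr (by omega))
        (show f (2 * k + 1) = f (2 * l + 1) by omega)
      omega

variable {w : EvenClosedWalk G}

/-- A primitive walk does not return to a vertex after a proper even number of steps. -/
lemma IsPrimitive.parity_ne (hw : w.IsPrimitive) {a b : ℕ} (hab : a < b) (hb : b < 2 * w.q)
    (hv : w.verts a = w.verts b) : a % 2 ≠ b % 2 := by
  intro hpar
  have hlen : 2 * ((b - a) / 2) = b - a := by omega
  rcases Nat.mod_two_eq_zero_or_one a with ha | ha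
  · let ξ : EvenClosedWalk G :=
      { q := (b - a) / 2
        verts := fun t => w.verts (a + t)
        adj := fun t ht => w.adj (a + t) (by omega)
        closed := by rw [hlen, Nat.add_sub_cancel' hab.le, Nat.add_zero, hv] }
    have hq : ξ.q = (b - a) / 2 := rfl
    refine hw.2 ξ (by omega) (by omega) (exp_le_exp ξ w (fun t => a + t) ?_ ?_ ?_ ?_)
    · intro t ht
      omega
    · intro s _ t _ h
      exact Nat.add_left_cancel h
    · intro t ht
      omega
    · intro t ht
      rfl
  · let u : ℕ → V := fun t => if t < b - a then w.verts (a + 1 + t) else w.verts (a + 1)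
    let f : ℕ → ℕ := fun t => if t < b - a - 1 then a + 1 + t else a
    have hedge : ∀ t < b - a, s(u t, u (t + 1)) = s(w.verts (f t), w.verts (f t + 1)) := by
      intro t ht
      rcases Nat.lt_or_ge t (b - a - 1) with h | h
      · simp only [u, f, if_pos ht, if_pos h, if_pos (show t + 1 < b - a by omega)]
        rfl
      · simp only [u, f, if_pos ht, if_neg (show ¬ t < b - a - 1 by omega),
          if_neg (show ¬ t + 1 < b - a by omega)]
        rw [show a + 1 + t = b by omega, hv]
    have hf : ∀ t < b - a, f t < 2 * w.q := by
      intro t ht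
      simp only [f]
      split_ifs <;> omega
    let ξ : EvenClosedWalk G :=
      { q := (b - a) / 2
        verts := u
        adj := fun t ht => by
          rw [← SimpleGraph.mem_edgeSet, hedge t (by omega), SimpleGraph.mem_edgeSet]
          exact w.adj _ (hf t (by omega))
        closed := by
          simp only [u, hlen, if_neg (lt_irrefl _), if_pos (show 0 < b - a by omega),
            Nat.add_zero] }
    have hq : 2 * ξ.q = b - a := hlen
    refine hw.2 ξ (by omega) (by omega) (exp_le_exp ξ w f ?_ ?_ ?_ ?_)
    · exact fun t ht => hf t (by omega)
    · intro s hs t ht h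
      rw [Set.mem_Iio] at hs ht
      simp only [f] at h
      split_ifs at h <;> omega
    · intro t ht
      simp only [f]
      split_ifs <;> omega
    · exact fun t ht => hedge t (by omega)

/-- Reversing an odd closed section of a primitive walk gives a primitive walk. -/
lemma IsPrimitive.exists_reverse (hw : w.IsPrimitive) {i j : ℕ} (hij : i < j) (hj : j < 2 * w.q)
    (hv : w.verts i = w.verts j) : ∃ u : EvenClosedWalk G, u.IsPrimitive ∧ u.q = w.q ∧
      ∀ t, u.verts t = w.verts (if i ≤ t ∧ t ≤ j then i + j - t else t) := by
  have hpar := hw.parity_ne hij hj hv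
  let g : ℕ → ℕ := fun t => if i ≤ t ∧ t ≤ j then i + j - t else t
  let f : ℕ → ℕ := fun t => if i ≤ t ∧ t < j then i + j - 1 - t else t
  have hedge : ∀ t, s(w.verts (g t), w.verts (g (t + 1))) =
      s(w.verts (f t), w.verts (f t + 1)) := by
    intro t
    by_cases h : i ≤ t ∧ t < j
    · simp only [g, f, if_pos h, if_pos (show i ≤ t ∧ t ≤ j by omega),
        if_pos (show i ≤ t + 1 ∧ t + 1 ≤ j by omega)]
      rw [Sym2.eq_swap, show i + j - (t + 1) = i + j - 1 - t by omega,
        show i + j - 1 - t + 1 = i + j - t by omega]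
    · simp only [f, if_neg h]
      have h₁ : w.verts (g t) = w.verts t := by
        by_cases ht : t = j
        · subst ht
          simp only [g, if_pos (show i ≤ t ∧ t ≤ t by omega), Nat.add_sub_cancel, hv]
        · simp only [g, if_neg (show ¬ (i ≤ t ∧ t ≤ j) by omega)]
      have h₂ : w.verts (g (t + 1)) = w.verts (t + 1) := by
        by_cases ht : t + 1 = i
        · simp only [g, if_pos (show i ≤ t + 1 ∧ t + 1 ≤ j by omega)]
          rw [ht, Nat.add_sub_cancel_left, hv]
        · simp only [g, if_neg (show ¬ (i ≤ t + 1 ∧ t + 1 ≤ j) by omega)]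
      rw [h₁, h₂]
  have hf : ∀ t < 2 * w.q, f t < 2 * w.q := by
    intro t ht
    simp only [f]
    split_ifs <;> omega
  have hg0 : w.verts (g 0) = w.verts 0 := by
    by_cases hi : i = 0
    · subst hi
      simp [g, hv]
    · simp only [g, if_neg (show ¬ (i ≤ 0 ∧ 0 ≤ j) by omega)]
  let u : EvenClosedWalk G :=
    { q := w.q
      verts := fun t => w.verts (g t)
      adj := fun t ht => by
        rw [← SimpleGraph.mem_edgeSet, hedge t, SimpleGraph.mem_edgeSet]
        exact w.adj _ (hf t ht)
      closed := by
        rw [hg0, ← w.closed]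
        simp only [g, if_neg (show ¬ (i ≤ 2 * w.q ∧ 2 * w.q ≤ j) by omega)] }
  have hle := exp_le_exp u w f hf
    (by
      intro s _ t _ h
      simp only [f] at h
      split_ifs at h <;> omega)
    (by
      intro t _
      simp only [f]
      split_ifs <;> omega)
    (fun t _ => hedge t)
  exact ⟨u, ⟨hw.1, fun ξ h₁ h₂ h₃ => hw.2 ξ h₁ h₂ ⟨h₃.1.trans hle.1, h₃.2.trans hle.2⟩⟩, rfl,
    fun t => rfl⟩

lemma IsPrimitive.isNoncrossing (hw : w.IsPrimitive) : IsNoncrossing (2 * w.q) w.verts := by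
  have hpar : ∀ {a b : ℕ}, a ≠ b → a < 2 * w.q → b < 2 * w.q → w.verts a = w.verts b →
      a % 2 ≠ b % 2 := by
    intro a b hab ha hb hv
    rcases Nat.lt_or_gt_of_ne hab with h | h
    · exact hw.parity_ne h hb hv
    · exact (hw.parity_ne h ha hv.symm).symm
  intro i j hij hj hv k l hik hkj hl hlij hkl
  have h₁ := hpar hij.ne (by omega) hj hv
  have h₂ := hpar (show k ≠ l by omega) (by omega) hl hkl
  rcases hik.eq_or_lt with rfl | hik
  · refine ⟨rfl, ?_⟩
    by_contra hlj
    have := hpar hlj hl hj (hkl.symm.trans hv)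
    omega
  by_cases hlj : l = j
  · subst hlj
    have := hpar hik.ne (by omega) (by omega) (hv.trans hkl.symm)
    omega
  · obtain ⟨u, hu, huq, hverts⟩ := hw.exists_reverse hij hj hv
    have hk : u.verts (i + j - k) = w.verts k := by
      rw [hverts, if_pos (by omega), show i + j - (i + j - k) = k by omega]
    have hl' : u.verts l = w.verts l := by
      rw [hverts, if_neg (by omega)]
    have hul : u.verts (i + j - k) = u.verts l := by rw [hk, hl', hkl]
    rcases Nat.lt_or_gt_of_ne (show i + j - k ≠ l by omega) with h | h
    · have := hu.parity_ne h (by omega) hul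
      omega
    · have := hu.parity_ne h (by omega) hul.symm
      omega

end EvenClosedWalk

/-- For a primitive even closed walk `w` of a finite simple graph on `n`
vertices with `s` blocks in `𝐰`, one has `2 deg(B_w) ≤ n + s - 1`; moreover `2 deg(B_w)`
(the length `2q` of `w`) equals the total number of edges of the cyclic blocks of `𝐰` plus
twice the number of blocks of `𝐰` that are cut edges. -/
theorem two_mul_deg_Bw_le {V : Type*} [Fintype V] {G : SimpleGraph V}
    (w : EvenClosedWalk G) (hw : w.IsPrimitive) (n s : ℕ) (hn : Fintype.card V = n)
    (hs : s = Set.ncard {B : SimpleGraph V | IsBlock w.graph B}) :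
    2 * w.q ≤ n + s - 1 ∧
      2 * w.q =
        Set.ncard {e : Sym2 V | ∃ B : SimpleGraph V,
            IsBlock w.graph B ∧ IsCycleGraph B ∧ e ∈ B.edgeSet} +
          2 * Set.ncard {B : SimpleGraph V |
            IsBlock w.graph B ∧ ∃ e, B.edgeSet = {e} ∧ IsCutEdge w.graph e} := by
  have hc : IsCactusOfLength w.graph (2 * w.q) :=
    hw.isNoncrossing.isCactusOfLength (Nat.mul_pos two_pos hw.1) (fun i hi => (w.adj i hi).ne)
      w.closed
  have hset : {B : SimpleGraph V | IsBlock w.graph B ∧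
      ∃ e, B.edgeSet = {e} ∧ IsCutEdge w.graph e} = edgeBlocks w.graph := by
    ext B
    exact ⟨fun ⟨hB, e, he, _⟩ => ⟨hB, e, he⟩,
      fun ⟨hB, e, he⟩ => ⟨hB, e, he, hc.isCutEdge B e hB he⟩⟩
  constructor
  · have h₁ := hc.support_add_blocks
    have h₂ : w.graph.support.ncard ≤ n := by
      rw [← hn, ← Nat.card_eq_fintype_card]
      exact Set.ncard_le_card _
    omega
  · rw [hset]
    exact hc.length_eq

end
end
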